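/- arXiv:1707.07488 — 3 statements merged into one kernel-verified Lean document; each statement's English description precedes it below -/
import Mathlib

section
/- Fix an integer s ≥ 2 and let ξ ∈ ℚ_s ∩ (0, s/(s+1)). Then ξ is the pseudocenter of the connected component of [0, s/(s+1)] \ E containing it if and only if g^k(ξ) ∉ (0, ξ) for all k ≥ 1. -/
/-- The value `.w = Σ εᵢ s^{-i}` of a finite word of digits in base `s`. -/
noncomputable def sval (s : ℕ) (w : List ℕ) : ℝ :=
  w.foldr (fun d r => ((d : ℝ) + r) / s) 0

/-- `x` is an `s`-adic rational `p/s^m`. -/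
def IsSAdic (s : ℕ) (x : ℝ) : Prop := ∃ p m : ℕ, x = (p : ℝ) / (s : ℝ) ^ m

/-- `m` is the minimal exponent with `x = p/s^m` for some integer `p`. -/
def MinDen (s : ℕ) (x : ℝ) (m : ℕ) : Prop :=
  (∃ p : ℕ, x = (p : ℝ) / (s : ℝ) ^ m) ∧
  ∀ n : ℕ, (∃ p : ℕ, x = (p : ℝ) / (s : ℝ) ^ n) → m ≤ n

/-- The map `g(x) = s(1 − x) mod 1`. -/
noncomputable def gmap (s : ℕ) (x : ℝ) : ℝ := Int.fract ((s : ℝ) * (1 - x))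

/-- The bifurcation set `E = {γ ∈ [0,1] : g^k(γ) ≥ γ for all k ≥ 1}`. -/
noncomputable def Eset (s : ℕ) : Set ℝ :=
  {γ ∈ Set.Icc (0 : ℝ) 1 | ∀ k : ℕ, 1 ≤ k → γ ≤ (gmap s)^[k] γ}

/-- `ξ` is the pseudocenter of its connected component of `[0, s/(s+1)] \ E`: it lies in the
matching set and is the unique `s`-adic rational of minimal denominator in its component. -/
noncomputable def IsPseudocenter (s : ℕ) (ξ : ℝ) : Prop :=
  ξ ∈ Set.Icc (0 : ℝ) ((s : ℝ) / (s + 1)) \ Eset s ∧ IsSAdic s ξ ∧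
  ∀ ξ' ∈ connectedComponentIn (Set.Icc (0 : ℝ) ((s : ℝ) / (s + 1)) \ Eset s) ξ,
    IsSAdic s ξ' → ξ' ≠ ξ → ∀ m m' : ℕ, MinDen s ξ m → MinDen s ξ' m' → m < m'

lemma gmap_iterate (s : ℕ) (x : ℝ) {k : ℕ} (hk : 1 ≤ k) :
    (gmap s)^[k] x = Int.fract ((-(s : ℝ)) ^ k * x) := by
  have h : ∀ y : ℝ, gmap s y = Int.fract (-(s : ℝ) * y) := fun y =>
    Int.fract_eq_fract.mpr ⟨s, by push_cast; ring⟩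
  induction k, hk using Nat.le_induction with
  | base => simp [h]
  | succ k _ ih =>
    rw [Function.iterate_succ_apply', ih, h]
    refine Int.fract_eq_fract.mpr ⟨s * ⌊(-(s : ℝ)) ^ k * x⌋, ?_⟩
    rw [Int.fract]
    push_cast
    ring

lemma div_add_one_mem_Eset (s : ℕ) : (s : ℝ) / (s + 1) ∈ Eset s := by
  have hpos : (0 : ℝ) < s + 1 := by positivity
  have hfix : gmap s ((s : ℝ) / (s + 1)) = (s : ℝ) / (s + 1) := by
    refine Int.fract_eq_iff.mpr ⟨by positivity, ?_, 0, ?_⟩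
    · rw [div_lt_one hpos]; linarith
    · field_simp; push_cast; ring
  refine ⟨⟨by positivity, ?_⟩, fun k _ => (Function.iterate_fixed hfix k).ge⟩
  rw [div_le_one hpos]
  linarith

lemma exists_minDen_le {s : ℕ} {x : ℝ} {p n : ℕ} (h : x = (p : ℝ) / (s : ℝ) ^ n) :
    ∃ m ≤ n, MinDen s x m := by
  classical
  have hex : ∃ n : ℕ, ∃ p : ℕ, x = (p : ℝ) / (s : ℝ) ^ n := ⟨n, p, h⟩
  exact ⟨Nat.find hex, Nat.find_min' hex ⟨p, h⟩, Nat.find_spec hex,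
    fun _ hn => Nat.find_min' hex hn⟩

lemma neg_pow_mul_eq_intCast {s : ℕ} (hs : 2 ≤ s) {p m k : ℕ} (h : m ≤ k) :
    ∃ z : ℤ, (-(s : ℝ)) ^ k * ((p : ℝ) / (s : ℝ) ^ m) = z := by
  have hS : (s : ℝ) ≠ 0 := by positivity
  obtain ⟨j, rfl⟩ := Nat.exists_eq_add_of_le h
  refine ⟨(-1) ^ (m + j) * s ^ j * p, ?_⟩
  rw [neg_pow, pow_add (s : ℝ)]
  push_cast
  field_simp

lemma fract_neg_pow_mul_eq_div {s : ℕ} (hs : 2 ≤ s) {p m k : ℕ} (h : k ≤ m) :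
    ∃ q : ℕ, Int.fract ((-(s : ℝ)) ^ k * ((p : ℝ) / (s : ℝ) ^ m)) =
      (q : ℝ) / (s : ℝ) ^ (m - k) := by
  have hS : (0 : ℝ) < s := by positivity
  obtain ⟨j, rfl⟩ := Nat.exists_eq_add_of_le h
  rw [Nat.add_sub_cancel_left]
  set y := (-(s : ℝ)) ^ k * ((p : ℝ) / (s : ℝ) ^ (k + j)) with hy
  have hz : Int.fract y * (s : ℝ) ^ j = (((-1) ^ k * p - ⌊y⌋ * s ^ j : ℤ) : ℝ) := by
    rw [Int.fract, sub_mul]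
    push_cast
    congr 1
    rw [hy, neg_pow, pow_add]
    field_simp
  have hnn : (0 : ℤ) ≤ (-1) ^ k * p - ⌊y⌋ * s ^ j := by
    have := mul_nonneg (Int.fract_nonneg y) (pow_pos hS j).le
    rw [hz] at this
    exact_mod_cast this
  obtain ⟨q, hq⟩ := Int.eq_ofNat_of_zero_le hnn
  refine ⟨q, ?_⟩
  rw [eq_div_iff (by positivity), hz, hq]
  simp

/-- Distinct points of the grid `s⁻ᵐ ℕ` are at distance at least `s⁻ᵐ`. -/
lemma add_inv_pow_le {s : ℕ} (hs : 2 ≤ s) {p q m n : ℕ} (hn : n ≤ m)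
    (h : (p : ℝ) / (s : ℝ) ^ m < (q : ℝ) / (s : ℝ) ^ n) :
    (p : ℝ) / (s : ℝ) ^ m + 1 / (s : ℝ) ^ m ≤ (q : ℝ) / (s : ℝ) ^ n := by
  have hS : (0 : ℝ) < s := by positivity
  obtain ⟨j, rfl⟩ := Nat.exists_eq_add_of_le hn
  have e : (q : ℝ) / (s : ℝ) ^ n = ((q * s ^ j : ℕ) : ℝ) / (s : ℝ) ^ (n + j) := by
    push_cast
    rw [pow_add]
    field_simp
  rw [e, div_lt_div_iff_of_pos_right (by positivity)] at h
  rw [e, ← add_div, div_le_div_iff_of_pos_right (by positivity)]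
  exact_mod_cast h

lemma fract_ne_zero_of_lt_minDen {s : ℕ} (hs : 2 ≤ s) {ξ : ℝ} {m k : ℕ} (h0 : 0 < ξ)
    (hm : MinDen s ξ m) (hk : k < m) : Int.fract ((-(s : ℝ)) ^ k * ξ) ≠ 0 := by
  have hS : (0 : ℝ) < s := by positivity
  intro h
  obtain ⟨z, hz⟩ := Int.fract_eq_iff.mp h |>.2.2
  have habs : ξ * (s : ℝ) ^ k = (z.natAbs : ℝ) := by
    rw [Nat.cast_natAbs, Int.cast_abs, ← hz, sub_zero, abs_mul, abs_pow, abs_neg,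
      abs_of_pos h0, abs_of_pos hS, mul_comm]
  exact hk.not_ge (hm.2 k ⟨_, eq_div_of_mul_eq (by positivity) habs⟩)

lemma fract_ne_self_of_lt_minDen {s : ℕ} (hs : 2 ≤ s) {ξ : ℝ} {m k : ℕ}
    (hm : MinDen s ξ m) (hk : 1 ≤ k) (hkm : k < m) : Int.fract ((-(s : ℝ)) ^ k * ξ) ≠ ξ := by
  intro h
  obtain ⟨p, hp⟩ := hm.1
  obtain ⟨q, hq⟩ := fract_neg_pow_mul_eq_div hs (p := p) hkm.le
  rw [← hp, h] at hq
  have := hm.2 (m - k) ⟨q, hq⟩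
  omega

/-- A return of the orbit of `γ` strictly below `γ` at time `k` forces a return strictly below `γ`
at the complementary time `N - k`, at an expanded distance. -/
lemma sub_fract_complementary {s : ℕ} (hs : 2 ≤ s) {ξ γ : ℝ} {m k j : ℕ} (h0 : 0 < ξ)
    (hm : MinDen s ξ m)
    (hc : ∀ k : ℕ, 1 ≤ k → Int.fract ((-(s : ℝ)) ^ k * ξ) ∉ Set.Ioo 0 ξ)
    (hk : 1 ≤ k) (hj : 1 ≤ j) (hmN : m ≤ k + j) (hNm : k + j ≤ m + 1)
    (hγ : (-(s : ℝ)) ^ (k + j) * (γ - ξ) = γ) (hγ0 : 0 < γ) (hγ1 : γ ≤ (s : ℝ) / (s + 1))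
    (hlt : Int.fract ((-(s : ℝ)) ^ k * γ) < γ) :
    γ - Int.fract ((-(s : ℝ)) ^ j * γ) =
      (s : ℝ) ^ j * (γ - Int.fract ((-(s : ℝ)) ^ k * γ)) := by
  have hS : (0 : ℝ) < s := by positivity
  have hS2 : (2 : ℝ) ≤ s := by exact_mod_cast hs
  have hγs : γ * (s + 1) ≤ s := by rwa [le_div_iff₀ (by positivity)] at hγ1
  have hγlt : γ < 1 := by nlinarith
  obtain ⟨p, hp⟩ := hm.1
  obtain ⟨zN, hzN⟩ := neg_pow_mul_eq_intCast hs (p := p) hmN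
  rw [← hp] at hzN
  set Y := Int.fract ((-(s : ℝ)) ^ k * ξ) with hY
  have hYeq : (-(s : ℝ)) ^ k * ξ = Y + ⌊(-(s : ℝ)) ^ k * ξ⌋ := (Int.fract_add_floor _).symm
  have hsj : (0 : ℝ) < (s : ℝ) ^ j := by positivity
  have hδ0 : 0 < γ / (s : ℝ) ^ j := by positivity
  have hshift : (-(s : ℝ)) ^ k * γ = (-(s : ℝ)) ^ k * ξ + (-1) ^ j * (γ / (s : ℝ) ^ j) := by
    have h1 : ((-1 : ℝ) ^ j) * (-1) ^ j = 1 := by rw [← mul_pow]; norm_num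
    have h2 : (-(s : ℝ)) ^ k * ((-1) ^ j * (s : ℝ) ^ j) * (γ - ξ) = γ := by
      rw [← neg_pow, ← pow_add, hγ]
    have h3 : (-(s : ℝ)) ^ k * (γ - ξ) = (-1) ^ j * (γ / (s : ℝ) ^ j) := by
      field_simp
      linear_combination (-1) ^ j * h2 - (-(s : ℝ)) ^ k * (s : ℝ) ^ j * (γ - ξ) * h1
    linarith
  have hgrid : k < m → γ < Y := by
    intro hkm
    obtain ⟨q, hq⟩ := fract_neg_pow_mul_eq_div hs (p := p) hkm.le
    rw [← hp, ← hY] at hq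
    have hYge : ξ ≤ Y := by
      by_contra hcon
      exact hc k hk ⟨lt_of_le_of_ne (Int.fract_nonneg _)
        (fract_ne_zero_of_lt_minDen hs h0 hm hkm).symm, not_le.mp hcon⟩
    have hYgt : ξ < Y := lt_of_le_of_ne hYge (fract_ne_self_of_lt_minDen hs hm hk hkm).symm
    have hstep : ξ + 1 / (s : ℝ) ^ m ≤ Y := by
      rw [hq, hp]
      apply add_inv_pow_le hs (by omega)
      rwa [← hp, ← hq]
    refine lt_of_lt_of_le ?_ hstep
    have habs : (s : ℝ) ^ (k + j) * |γ - ξ| = γ := by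
      have := congrArg abs hγ
      rwa [abs_mul, abs_pow, abs_neg, abs_of_pos hS, abs_of_pos hγ0] at this
    have hle : (s : ℝ) ^ m ≤ (s : ℝ) ^ (k + j) := pow_le_pow_right₀ (by linarith) hmN
    have : γ - ξ < 1 / (s : ℝ) ^ m := by
      rw [lt_div_iff₀ (by positivity)]
      calc (γ - ξ) * (s : ℝ) ^ m ≤ |γ - ξ| * (s : ℝ) ^ (k + j) := by
            gcongr
            exact le_abs_self _
        _ < 1 := by rw [mul_comm, habs]; exact hγlt
    linarith
  rcases Nat.even_or_odd j with he | ho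
  · exfalso
    have hkm : k < m := by
      rcases he with ⟨r, hr⟩
      omega
    have hγY := hgrid hkm
    rw [he.neg_one_pow, one_mul] at hshift
    have hY1 : Y + γ / (s : ℝ) ^ j < 1 := by
      obtain ⟨q, hq⟩ := fract_neg_pow_mul_eq_div hs (p := p) hkm.le
      rw [← hp, ← hY] at hq
      have h1 : (q : ℝ) / (s : ℝ) ^ (m - k) < ((1 : ℕ) : ℝ) / (s : ℝ) ^ 0 := by
        rw [← hq]
        simpa using Int.fract_lt_one _
      have h2 := add_inv_pow_le hs (Nat.zero_le _) h1
      rw [← hq] at h2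
      have h3 : γ / (s : ℝ) ^ j < 1 / (s : ℝ) ^ (m - k) := by
        have : (s : ℝ) ^ (m - k) ≤ (s : ℝ) ^ j := pow_le_pow_right₀ (by linarith) (by omega)
        calc γ / (s : ℝ) ^ j < 1 / (s : ℝ) ^ j := by gcongr
          _ ≤ _ := by gcongr
      simp at h2 h3
      linarith
    have : Int.fract ((-(s : ℝ)) ^ k * γ) = Y + γ / (s : ℝ) ^ j :=
      Int.fract_eq_iff.mpr ⟨by linarith, hY1, ⌊(-(s : ℝ)) ^ k * ξ⌋, by linarith⟩
    linarith
  · rw [ho.neg_one_pow] at hshift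
    have hkm : k < m := by
      by_contra hcon
      obtain rfl : k = m := by omega
      obtain rfl : j = 1 := by omega
      have hY0 : Y = 0 := by
        obtain ⟨z, hz⟩ := neg_pow_mul_eq_intCast hs (p := p) le_rfl
        rw [hY, hp, hz, Int.fract_intCast]
      have hge : γ ≤ 1 - γ / (s : ℝ) ^ 1 := by
        rw [pow_one, le_sub_iff_add_le, ← le_sub_iff_add_le', div_le_iff₀ hS]
        linarith
      have : Int.fract ((-(s : ℝ)) ^ k * γ) = 1 - γ / (s : ℝ) ^ 1 :=
        Int.fract_eq_iff.mpr ⟨by linarith, by linarith, ⌊(-(s : ℝ)) ^ k * ξ⌋ - 1, by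
          push_cast
          linarith⟩
      linarith
    have hγY := hgrid hkm
    have hδγ : γ / (s : ℝ) ^ j ≤ γ := div_le_self hγ0.le (one_le_pow₀ (by linarith))
    have hfk : Int.fract ((-(s : ℝ)) ^ k * γ) = Y - γ / (s : ℝ) ^ j :=
      Int.fract_eq_iff.mpr ⟨by linarith, by linarith [Int.fract_lt_one ((-(s : ℝ)) ^ k * ξ)],
        ⌊(-(s : ℝ)) ^ k * ξ⌋, by linarith⟩
    set F := Int.fract ((-(s : ℝ)) ^ k * γ) with hF
    have hu : (s : ℝ) ^ j * (γ - F) < γ := by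
      have : γ - F < γ / (s : ℝ) ^ j := by linarith
      rwa [lt_div_iff₀ hsj, mul_comm] at this
    have hu0 : 0 < (s : ℝ) ^ j * (γ - F) := mul_pos hsj (by linarith)
    have hfj : Int.fract ((-(s : ℝ)) ^ j * γ) = γ - (s : ℝ) ^ j * (γ - F) := by
      refine Int.fract_eq_iff.mpr ⟨by linarith, by linarith,
        zN - (-s) ^ j * ⌊(-(s : ℝ)) ^ k * γ⌋, ?_⟩
      have hFe : F = (-(s : ℝ)) ^ k * γ - ⌊(-(s : ℝ)) ^ k * γ⌋ := rfl
      have hpj : (-(s : ℝ)) ^ j = -(s : ℝ) ^ j := ho.neg_pow _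
      push_cast
      rw [← hzN]
      linear_combination (-(s : ℝ)) ^ j * hFe + hγ + (γ - F) * hpj - γ * pow_add (-(s : ℝ)) k j
    linarith

lemma mem_Eset_of_neg_pow_mul_sub_eq {s : ℕ} (hs : 2 ≤ s) {ξ γ : ℝ} {m N : ℕ} (h0 : 0 < ξ)
    (hm : MinDen s ξ m)
    (hc : ∀ k : ℕ, 1 ≤ k → Int.fract ((-(s : ℝ)) ^ k * ξ) ∉ Set.Ioo 0 ξ)
    (hN : 1 ≤ N) (hmN : m ≤ N) (hNm : N ≤ m + 1)
    (hγ : (-(s : ℝ)) ^ N * (γ - ξ) = γ) (hγ0 : 0 < γ) (hγ1 : γ ≤ (s : ℝ) / (s + 1)) :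
    γ ∈ Eset s := by
  have hS2 : (2 : ℝ) ≤ s := by exact_mod_cast hs
  have hγlt : γ < 1 := hγ1.trans_lt (by rw [div_lt_one (by positivity)]; linarith)
  refine ⟨⟨hγ0.le, hγlt.le⟩, fun k _ => ?_⟩
  have hper : Function.IsPeriodicPt (gmap s) N γ := by
    obtain ⟨p, hp⟩ := hm.1
    obtain ⟨z, hz⟩ := neg_pow_mul_eq_intCast hs (p := p) hmN
    rw [← hp] at hz
    change (gmap s)^[N] γ = γ
    rw [gmap_iterate s γ hN]
    exact Int.fract_eq_iff.mpr ⟨hγ0.le, hγlt, z, by linarith⟩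
  rw [← hper.iterate_mod_apply k]
  have hlt : k % N < N := Nat.mod_lt k hN
  generalize k % N = r at hlt
  rcases Nat.eq_zero_or_pos r with rfl | hr
  · exact le_rfl
  rw [gmap_iterate s γ hr]
  by_contra hcon
  rw [not_le] at hcon
  obtain ⟨j, rfl⟩ := Nat.exists_eq_add_of_lt hlt
  rw [add_assoc] at *
  generalize hj : j + 1 = i at *
  have hi : 1 ≤ i := by omega
  have e1 := sub_fract_complementary hs h0 hm hc hr hi hmN hNm hγ hγ0 hγ1 hcon
  have hpos : 0 < (s : ℝ) ^ i * (γ - Int.fract ((-(s : ℝ)) ^ r * γ)) :=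
    mul_pos (by positivity) (by linarith)
  have e2 := sub_fract_complementary hs h0 hm hc hi hr (by omega) (by omega)
    (by rwa [add_comm i r]) hγ0 hγ1 (by linarith)
  have h1 : (1 : ℝ) ≤ (s : ℝ) ^ i := one_le_pow₀ (by linarith)
  have h2 : (1 : ℝ) < (s : ℝ) ^ r := one_lt_pow₀ (by linarith) (by omega)
  nlinarith

lemma notMem_Ioo_of_isPseudocenter {s : ℕ} (hs : 2 ≤ s) {ξ : ℝ} (h0 : 0 < ξ)
    (h1 : ξ < (s : ℝ) / (s + 1)) (h : IsPseudocenter s ξ) {k : ℕ} (hk : 1 ≤ k) :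
    Int.fract ((-(s : ℝ)) ^ k * ξ) ∉ Set.Ioo 0 ξ := by
  rintro ⟨hpos, hlt⟩
  have hS : (0 : ℝ) < s := by positivity
  have hS2 : (2 : ℝ) ≤ s := by exact_mod_cast hs
  have hsk : (0 : ℝ) < (s : ℝ) ^ k := by positivity
  obtain ⟨hmem, ⟨p, n, hp⟩, huniq⟩ := h
  obtain ⟨m, -, hm⟩ := exists_minDen_le hp
  have hkm : k < m := by
    by_contra hcon
    obtain ⟨q, hq⟩ := hm.1
    obtain ⟨z, hz⟩ := neg_pow_mul_eq_intCast hs (p := q) (not_lt.mp hcon)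
    rw [hq, hz, Int.fract_intCast] at hpos
    exact hpos.false
  have hout : ∀ q : ℕ, (q : ℝ) / (s : ℝ) ^ k ∉
      connectedComponentIn (Set.Icc (0 : ℝ) ((s : ℝ) / (s + 1)) \ Eset s) ξ := by
    intro q hq
    obtain ⟨m', hm', hmin⟩ := exists_minDen_le (s := s) (p := q) (n := k) rfl
    have hne : (q : ℝ) / (s : ℝ) ^ k ≠ ξ := fun he => by
      have := hm.2 k ⟨q, he.symm⟩
      omega
    have := huniq _ hq ⟨q, k, rfl⟩ hne m m' hm hmin
    omega
  rcases Nat.even_or_odd k with he | ho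
  · rw [he.neg_pow] at hpos hlt
    have hfl : ((⌊(s : ℝ) ^ k * ξ⌋₊ : ℕ) : ℝ) / (s : ℝ) ^ k ≤ ξ := by
      rw [div_le_iff₀ hsk, mul_comm]
      exact Nat.floor_le (by positivity)
    obtain ⟨e, he1, he2, heE⟩ : ∃ e, ((⌊(s : ℝ) ^ k * ξ⌋₊ : ℕ) : ℝ) / (s : ℝ) ^ k ≤ e ∧
        e ≤ ξ ∧ e ∈ Eset s := by
      by_contra! hcon
      refine hout _ (isPreconnected_Icc.subset_connectedComponentIn ⟨hfl, le_rfl⟩ ?_ ⟨le_rfl, hfl⟩)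
      intro x hx
      exact ⟨⟨le_trans (by positivity) hx.1, hx.2.trans h1.le⟩, hcon x hx.1 hx.2⟩
    have hge := heE.2 k hk
    rw [gmap_iterate s e hk, he.neg_pow] at hge
    have hfe : ⌊(s : ℝ) ^ k * e⌋ = ⌊(s : ℝ) ^ k * ξ⌋ := by
      apply le_antisymm
      · exact Int.floor_le_floor (by gcongr)
      · rw [Int.le_floor]
        rw [div_le_iff₀ hsk, mul_comm e] at he1
        refine le_trans (le_of_eq ?_) he1
        exact (natCast_floor_eq_intCast_floor (by positivity)).symm
    rw [Int.fract, hfe] at hge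
    rw [Int.fract] at hlt
    have : (1 : ℝ) ≤ (s : ℝ) ^ k := one_le_pow₀ (by linarith)
    nlinarith
  · rw [ho.neg_pow] at hpos hlt
    have hcl : ξ ≤ ((⌈(s : ℝ) ^ k * ξ⌉₊ : ℕ) : ℝ) / (s : ℝ) ^ k := by
      rw [le_div_iff₀ hsk, mul_comm]
      exact Nat.le_ceil _
    obtain ⟨e, he1, he2, heE⟩ : ∃ e, ξ ≤ e ∧
        e ≤ ((⌈(s : ℝ) ^ k * ξ⌉₊ : ℕ) : ℝ) / (s : ℝ) ^ k ∧ e ∈ Eset s := by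
      by_contra! hcon
      refine hout _ (isPreconnected_Icc.subset_connectedComponentIn ⟨le_rfl, hcl⟩ ?_ ⟨hcl, le_rfl⟩)
      intro x hx
      refine ⟨⟨h0.le.trans hx.1, ?_⟩, hcon x hx.1 hx.2⟩
      by_contra! hx1
      exact hcon _ h1.le (hx1.le.trans hx.2) (div_add_one_mem_Eset s)
    have hge := heE.2 k hk
    rw [gmap_iterate s e hk, ho.neg_pow] at hge
    rw [le_div_iff₀ hsk, mul_comm] at he2
    have hfe : ⌊-(s : ℝ) ^ k * e⌋ = ⌊-(s : ℝ) ^ k * ξ⌋ := by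
      rw [neg_mul, neg_mul, Int.floor_neg, Int.floor_neg, neg_inj]
      apply le_antisymm
      · rw [Int.ceil_le, ← natCast_ceil_eq_intCast_ceil (by positivity)]
        exact he2
      · exact Int.ceil_le_ceil (by gcongr)
    rw [Int.fract, hfe] at hge
    rw [Int.fract] at hlt
    nlinarith

lemma isPseudocenter_of_notMem_Ioo {s : ℕ} (hs : 2 ≤ s) {ξ : ℝ} (hξ : IsSAdic s ξ) (h0 : 0 < ξ)
    (h1 : ξ < (s : ℝ) / (s + 1))
    (hc : ∀ k : ℕ, 1 ≤ k → Int.fract ((-(s : ℝ)) ^ k * ξ) ∉ Set.Ioo 0 ξ) :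
    IsPseudocenter s ξ := by
  have hS : (0 : ℝ) < s := by positivity
  have hS2 : (2 : ℝ) ≤ s := by exact_mod_cast hs
  have hξ1 : ξ < 1 := h1.trans (by rw [div_lt_one (by positivity)]; linarith)
  have hmem : ξ ∈ Set.Icc (0 : ℝ) ((s : ℝ) / (s + 1)) \ Eset s := by
    refine ⟨⟨h0.le, h1.le⟩, fun hE => ?_⟩
    obtain ⟨p, n, hp⟩ := hξ
    have h := hE.2 (n + 1) (by omega)
    obtain ⟨z, hz⟩ := neg_pow_mul_eq_intCast hs (p := p) (Nat.le_succ n)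
    rw [gmap_iterate s ξ (by omega), hp, hz, Int.fract_intCast, ← hp] at h
    linarith
  refine ⟨hmem, hξ, fun ξ' hξ' _ hne m m' hm hm' => ?_⟩
  by_contra! hle
  obtain ⟨p, hp⟩ := hm.1
  obtain ⟨p', hp'⟩ := hm'.1
  have hsub := connectedComponentIn_subset (Set.Icc (0 : ℝ) ((s : ℝ) / (s + 1)) \ Eset s) ξ
  have hord := (isPreconnected_connectedComponentIn (x := ξ)
    (F := Set.Icc (0 : ℝ) ((s : ℝ) / (s + 1)) \ Eset s)).ordConnected
  have hself := mem_connectedComponentIn hmem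
  have hm1 : 1 ≤ m := by
    by_contra! hm0
    obtain rfl : m = 0 := by omega
    rw [pow_zero, div_one] at hp
    rw [hp] at h0 hξ1
    norm_cast at h0 hξ1
    omega
  rcases lt_or_gt_of_ne hne with hlt | hgt
  · obtain ⟨N, hmN, hNm, hodd⟩ : ∃ N, m ≤ N ∧ N ≤ m + 1 ∧ Odd N := by
      rcases Nat.even_or_odd m with h | h
      · exact ⟨m + 1, by omega, le_rfl, h.add_one⟩
      · exact ⟨m, le_rfl, by omega, h⟩
    have hsN : (0 : ℝ) < (s : ℝ) ^ N := by positivity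
    have hmle : (s : ℝ) ^ m ≤ (s : ℝ) ^ N := pow_le_pow_right₀ (by linarith) hmN
    set γ := (s : ℝ) ^ N * ξ / ((s : ℝ) ^ N + 1) with hγdef
    have hγ0 : 0 < γ := by positivity
    have hγe : γ * ((s : ℝ) ^ N + 1) = (s : ℝ) ^ N * ξ := by rw [hγdef]; field_simp
    have hγξ : γ < ξ := by nlinarith
    have hstep : ξ' + 1 / (s : ℝ) ^ m ≤ ξ := by
      have hj : ξ' = ((p' * s ^ (m - m') : ℕ) : ℝ) / (s : ℝ) ^ m := by
        rw [hp', ← Nat.add_sub_cancel' hle, pow_add, Nat.add_sub_cancel_left]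
        push_cast
        field_simp
      rw [hj, hp]
      apply add_inv_pow_le hs le_rfl
      rwa [← hj, ← hp]
    have hγ' : ξ' ≤ γ := by
      have : ξ - γ ≤ 1 / (s : ℝ) ^ m := by
        rw [le_div_iff₀ (by positivity)]
        calc (ξ - γ) * (s : ℝ) ^ m ≤ (ξ - γ) * (s : ℝ) ^ N := by gcongr
          _ ≤ 1 := by linarith
      linarith
    refine (hsub (hord.out hξ' hself ⟨hγ', hγξ.le⟩)).2
      (mem_Eset_of_neg_pow_mul_sub_eq hs h0 hm hc (by omega) hmN hNm ?_ hγ0 (by linarith))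
    rw [hodd.neg_pow]
    linarith
  · obtain ⟨N, hmN, hNm, heven⟩ : ∃ N, m ≤ N ∧ N ≤ m + 1 ∧ Even N := by
      rcases Nat.even_or_odd m with h | h
      · exact ⟨m, le_rfl, by omega, h⟩
      · exact ⟨m + 1, by omega, le_rfl, h.add_one⟩
    have hsN : (1 : ℝ) < (s : ℝ) ^ N := one_lt_pow₀ (by linarith) (by omega)
    have hsm : (0 : ℝ) < (s : ℝ) ^ m := by positivity
    have hmle : (s : ℝ) ^ m ≤ (s : ℝ) ^ N := pow_le_pow_right₀ (by linarith) hmN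
    have hN0 : (0 : ℝ) < (s : ℝ) ^ N - 1 := by linarith
    set γ := (s : ℝ) ^ N * ξ / ((s : ℝ) ^ N - 1) with hγdef
    have hγ0 : 0 < γ := by positivity
    have hγe : γ * ((s : ℝ) ^ N - 1) = (s : ℝ) ^ N * ξ := by rw [hγdef]; field_simp
    have hγξ : ξ < γ := by nlinarith
    have hstep : ξ + 1 / (s : ℝ) ^ m ≤ ξ' := by
      rw [hp, hp']
      apply add_inv_pow_le hs hle
      rwa [← hp, ← hp']
    have hp1 : ξ * (s : ℝ) ^ m ≤ (s : ℝ) ^ m - 1 := by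
      have h := add_inv_pow_le hs (p := p) (q := 1) (Nat.zero_le m) (by simpa [← hp] using hξ1)
      rw [← hp] at h
      simp only [Nat.cast_one, pow_zero, div_one] at h
      have := mul_le_mul_of_nonneg_right h hsm.le
      rw [add_mul, one_div, inv_mul_cancel₀ hsm.ne'] at this
      linarith
    have hγ' : γ ≤ ξ' := by
      have : γ - ξ ≤ 1 / (s : ℝ) ^ m := by
        rw [le_div_iff₀ hsm, ← mul_le_mul_iff_left₀ hN0]
        calc (γ - ξ) * (s : ℝ) ^ m * ((s : ℝ) ^ N - 1) = ξ * (s : ℝ) ^ m := by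
              linear_combination (s : ℝ) ^ m * hγe
          _ ≤ 1 * ((s : ℝ) ^ N - 1) := by linarith
      linarith
    have hγmem := hsub (hord.out hself hξ' ⟨hγξ.le, hγ'⟩)
    refine hγmem.2
      (mem_Eset_of_neg_pow_mul_sub_eq hs h0 hm hc (by omega) hmN hNm ?_ hγ0 hγmem.1.2)
    rw [heven.neg_pow]
    linarith

/-- an `s`-adic rational `ξ ∈ (0, s/(s+1))` is the pseudocenter of its
component of `[0, s/(s+1)] \ E` if and only if `g^k(ξ) ∉ (0, ξ)` for all `k ≥ 1`. -/
theorem pseudocenter_characterization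
    (s : ℕ) (hs : 2 ≤ s) (ξ : ℝ) (hξ : IsSAdic s ξ)
    (h0 : 0 < ξ) (h1 : ξ < (s : ℝ) / (s + 1)) :
    IsPseudocenter s ξ ↔ ∀ k : ℕ, 1 ≤ k → (gmap s)^[k] ξ ∉ Set.Ioo 0 ξ := by
  have hiter : (∀ k : ℕ, 1 ≤ k → (gmap s)^[k] ξ ∉ Set.Ioo 0 ξ) ↔
      ∀ k : ℕ, 1 ≤ k → Int.fract ((-(s : ℝ)) ^ k * ξ) ∉ Set.Ioo 0 ξ :=
    forall₂_congr fun k hk => by rw [gmap_iterate s ξ hk]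
  rw [hiter]
  exact ⟨fun h _ hk => notMem_Ioo_of_isPseudocenter hs h0 h1 h hk,
    isPseudocenter_of_notMem_Ioo hs hξ h0 h1⟩
end

section
/- Fix an integer s ≥ 2. Let ξ ∈ ℚ_s ∩ (0, s/(s+1)) be a pseudocenter, and let v be the shortest odd-length base-s expansion of 1 − ξ. Then ξ′ := .v̌v, the s-adic rational whose base-s expansion is the even-length word v̌v, is also a pseudocenter; equivalently, g^k(ξ′) ∉ (0, ξ′) for all k ≥ 1. -/
/-- Digit-wise flip `ε ↦ s − 1 − ε` of a word. -/
def flipw (s : ℕ) (w : List ℕ) : List ℕ := w.map (fun d => s - 1 - d)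

/-- `v` is the shortest base-`s` expansion of `x` of odd length. -/
noncomputable def IsOddExp (s : ℕ) (x : ℝ) (v : List ℕ) : Prop :=
  (∀ d ∈ v, d < s) ∧ Odd v.length ∧ sval s v = x ∧
  ∀ v' : List ℕ, (∀ d ∈ v', d < s) → Odd v'.length → sval s v' = x →
    v.length ≤ v'.length

/-- No iterate of `x` under multiplication by `-s` modulo `1` falls into `(0, x)`. -/
def AvoidsBelow (s : ℕ) (x : ℝ) : Prop :=
  ∀ k : ℕ, 1 ≤ k → Int.fract ((-(s : ℝ)) ^ k * x) ∉ Set.Ioo 0 x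

lemma gmap_eq_fract (s : ℕ) (x : ℝ) : gmap s x = Int.fract (-(s : ℝ) * x) := by
  have h : (s : ℝ) * (1 - x) = -(s : ℝ) * x + ((s : ℤ) : ℝ) := by push_cast; ring
  rw [gmap, h, Int.fract_add_intCast]

lemma gmap_fract (s : ℕ) (y : ℝ) : gmap s (Int.fract y) = Int.fract (-(s : ℝ) * y) := by
  rw [gmap_eq_fract, Int.fract_eq_fract]
  refine ⟨(s : ℤ) * ⌊y⌋, ?_⟩
  rw [Int.fract]; push_cast; ring

lemma gmap_iterate_succ (s : ℕ) (x : ℝ) (k : ℕ) :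
    (gmap s)^[k + 1] x = Int.fract ((-(s : ℝ)) ^ (k + 1) * x) := by
  induction k with
  | zero => simp [gmap_eq_fract]
  | succ k ih =>
    rw [Function.iterate_succ_apply', ih, gmap_fract]
    congr 1; ring

lemma fract_neg_pow_eq_zero {s n k : ℕ} {ξ : ℝ} {p : ℤ} (hp : (s : ℝ) ^ n * ξ = p)
    (h : n ≤ k) : Int.fract ((-(s : ℝ)) ^ k * ξ) = 0 := by
  obtain ⟨i, rfl⟩ := Nat.exists_eq_add_of_le h
  have : (-(s : ℝ)) ^ (n + i) * ξ = (((-1) ^ n * (-(s : ℤ)) ^ i * p : ℤ) : ℝ) := by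
    push_cast
    rw [← hp, pow_add, neg_pow (s : ℝ) n]; ring
  rw [this, Int.fract_intCast]

lemma fract_neg_pow_ne_self {s n k : ℕ} {ξ : ℝ} {p : ℤ} (hp : (s : ℝ) ^ n * ξ = p)
    (h0 : 0 < ξ) (hk : 1 ≤ k) : Int.fract ((-(s : ℝ)) ^ k * ξ) ≠ ξ := by
  intro h
  rw [← gmap_iterate s ξ hk] at h
  have h2 : ((gmap s)^[k])^[n + 1] ξ = ξ := Function.IsFixedPt.iterate h (n + 1)
  rw [← Function.iterate_mul, gmap_iterate s ξ (by nlinarith),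
    fract_neg_pow_eq_zero hp (by nlinarith)] at h2
  exact h0.ne h2

lemma pow_mul_fract_neg_pow {s n k j : ℕ} {ξ : ℝ} {p : ℤ} (hp : (s : ℝ) ^ n * ξ = p)
    (hkj : k + j = n) : ∃ c : ℤ, (s : ℝ) ^ j * Int.fract ((-(s : ℝ)) ^ k * ξ) = c := by
  refine ⟨(-1) ^ k * p - (s : ℤ) ^ j * ⌊(-(s : ℝ)) ^ k * ξ⌋, ?_⟩
  rw [Int.fract]; push_cast
  rw [← hp, ← hkj, neg_pow (s : ℝ) k, pow_add]; ring

lemma fract_neg_pow_complement {s n k j : ℕ} {ξ : ℝ} {p : ℤ} (hp : (s : ℝ) ^ n * ξ = p)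
    (hkj : k + j = n) (hj : Odd j)
    (h0 : 0 ≤ (s : ℝ) ^ j * (Int.fract ((-(s : ℝ)) ^ k * ξ) - ξ))
    (h1 : (s : ℝ) ^ j * (Int.fract ((-(s : ℝ)) ^ k * ξ) - ξ) < 1) :
    Int.fract ((-(s : ℝ)) ^ j * ξ) = (s : ℝ) ^ j * (Int.fract ((-(s : ℝ)) ^ k * ξ) - ξ) := by
  obtain ⟨c, hc⟩ := pow_mul_fract_neg_pow hp hkj
  rw [Int.fract_eq_iff]
  refine ⟨h0, h1, -c, ?_⟩
  rw [mul_sub, hc, hj.neg_pow]; push_cast; ring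

lemma le_fract_neg_pow_sub {s n k : ℕ} (hs : 2 ≤ s) {ξ : ℝ} (h0 : 0 < ξ)
    (h1 : ξ * (s + 1) < s) (hP : AvoidsBelow s ξ) (hn : Odd n) {p : ℤ}
    (hp : (s : ℝ) ^ n * ξ = p) (hmin : ∀ i < n, Odd i → ∀ a : ℤ, (s : ℝ) ^ i * ξ ≠ a)
    (hk : 1 ≤ k) (hkn : k < n) {t : ℝ} (ht0 : 0 < t) (ht : (s : ℝ) ^ n * t ≤ ξ) :
    ξ - t ≤ Int.fract ((-(s : ℝ)) ^ k * (ξ - t)) := by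
  obtain ⟨j, rfl⟩ := Nat.exists_eq_add_of_lt hkn
  have hs' : (2 : ℝ) ≤ s := by exact_mod_cast hs
  have hξ1 : ξ < 1 := by nlinarith
  have hJ : (s : ℝ) ≤ s ^ (j + 1) := le_self_pow₀ (by linarith) (by omega)
  have hK : (s : ℝ) ≤ s ^ k := le_self_pow₀ (by linarith) (by omega)
  have hkj : k + (j + 1) = k + j + 1 := by ring
  obtain ⟨c, hc⟩ := pow_mul_fract_neg_pow hp hkj
  have hcomp := fract_neg_pow_complement hp hkj
  have hne := fract_neg_pow_ne_self hp h0 hk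
  have hPk := hP k hk
  have hr0 := Int.fract_nonneg ((-(s : ℝ)) ^ k * ξ)
  have hr1 := Int.fract_lt_one ((-(s : ℝ)) ^ k * ξ)
  have hfl := Int.floor_add_fract ((-(s : ℝ)) ^ k * ξ)
  set r := Int.fract ((-(s : ℝ)) ^ k * ξ) with hr
  have hPj := hP (j + 1) (by omega)
  rw [← hkj, pow_add] at ht
  set J : ℝ := (s : ℝ) ^ (j + 1) with hJdef
  set K : ℝ := (s : ℝ) ^ k with hKdef
  have hKt0 : 0 < K * t := by positivity
  have hJKt : J * (K * t) ≤ ξ := by linarith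
  have hsKt : s * (K * t) ≤ ξ := by nlinarith
  have hrpos : 0 < r → 1 ≤ J * r := by
    intro h
    have : 0 < J * r := by positivity
    rw [hc] at this ⊢
    exact_mod_cast this
  have hrlt : J * r + 1 ≤ J := by
    have : J * r < J := by nlinarith
    rw [hc, hJdef] at this ⊢
    exact_mod_cast this
  rcases Nat.even_or_odd k with he | ho
  · rw [he.neg_pow, ← hKdef] at hfl ⊢
    rcases hr0.eq_or_lt with h | hpos
    · have : Int.fract (K * (ξ - t)) = 1 - K * t := by
        rw [Int.fract_eq_iff]
        refine ⟨by nlinarith, by linarith, ⌊K * ξ⌋ - 1, ?_⟩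
        push_cast; linarith
      rw [this]; nlinarith
    · have hge : ξ ≤ r := by
        by_contra! hlt
        exact hPk ⟨hpos, hlt⟩
      have hKr : K * t < r := by
        have := hrpos hpos
        by_contra! hcon
        nlinarith
      have : Int.fract (K * (ξ - t)) = r - K * t := by
        rw [Int.fract_eq_iff]
        refine ⟨by linarith, by linarith, ⌊K * ξ⌋, ?_⟩
        linarith
      rw [this]
      by_contra! hcon
      have hη : 0 < r - ξ := lt_of_le_of_ne (by linarith) (fun h => hne (by linarith))
      have hpos' : 0 < J * (r - ξ) := by positivity
      have hlt : J * (r - ξ) < ξ := by nlinarith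
      have hjo : Odd (j + 1) := by
        rcases Nat.even_or_odd (j + 1) with h | h
        · exact absurd hn (by rw [← hkj]; exact Nat.not_odd_iff_even.2 (he.add h))
        · exact h
      rw [hcomp hjo hpos'.le (by linarith)] at hPj
      exact hPj ⟨hpos', hlt⟩
  · rw [ho.neg_pow, ← hKdef] at hfl ⊢
    have hpos : 0 < r := by
      refine lt_of_le_of_ne hr0 fun h => hmin k hkn ho (-⌊-K * ξ⌋) ?_
      push_cast; linarith
    have hge : ξ ≤ r := by
      by_contra! hlt
      exact hPk ⟨hpos, hlt⟩
    have : Int.fract (-K * (ξ - t)) = r + K * t := by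
      rw [Int.fract_eq_iff]
      refine ⟨by linarith, by nlinarith, ⌊-K * ξ⌋, ?_⟩
      linarith
    rw [this]; linarith

lemma le_fract_neg_pow_add {s n k : ℕ} (hs : 2 ≤ s) {ξ : ℝ} (h0 : 0 < ξ)
    (hP : AvoidsBelow s ξ) (hn : Even n) {p : ℤ}
    (hp : (s : ℝ) ^ n * ξ = p)
    (hmin : ∀ i < n, Even i → 1 ≤ i → ∀ a : ℤ, (s : ℝ) ^ i * ξ ≠ a)
    (hk : 1 ≤ k) (hkn : k < n) {t : ℝ} (ht0 : 0 < t) (ht : (s : ℝ) ^ n * t = ξ + t)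
    (h1 : (ξ + t) * (s + 1) ≤ s) :
    ξ + t ≤ Int.fract ((-(s : ℝ)) ^ k * (ξ + t)) := by
  obtain ⟨j, rfl⟩ := Nat.exists_eq_add_of_lt hkn
  have hs' : (2 : ℝ) ≤ s := by exact_mod_cast hs
  have hξ1 : ξ + t < 1 := by nlinarith
  have hJ : (s : ℝ) ≤ s ^ (j + 1) := le_self_pow₀ (by linarith) (by omega)
  have hK : (s : ℝ) ≤ s ^ k := le_self_pow₀ (by linarith) (by omega)
  have hkj : k + (j + 1) = k + j + 1 := by ring
  have hjk : (j + 1) + k = k + j + 1 := by ring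
  obtain ⟨c, hc⟩ := pow_mul_fract_neg_pow hp hkj
  have hcomp := fract_neg_pow_complement hp hkj
  have hcomp' := fract_neg_pow_complement hp hjk
  have hne := fract_neg_pow_ne_self hp h0 hk
  have hPk := hP k hk
  have hr0 := Int.fract_nonneg ((-(s : ℝ)) ^ k * ξ)
  have hr1 := Int.fract_lt_one ((-(s : ℝ)) ^ k * ξ)
  have hfl := Int.floor_add_fract ((-(s : ℝ)) ^ k * ξ)
  set r := Int.fract ((-(s : ℝ)) ^ k * ξ) with hr
  have hPj := hP (j + 1) (by omega)
  rw [← hkj, pow_add] at ht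
  set J : ℝ := (s : ℝ) ^ (j + 1) with hJdef
  set K : ℝ := (s : ℝ) ^ k with hKdef
  have hKt0 : 0 < K * t := by positivity
  have hrpos : 0 < r → 1 ≤ J * r := by
    intro h
    have : 0 < J * r := by positivity
    rw [hc] at this ⊢
    exact_mod_cast this
  have hrlt : J * r + 1 ≤ J := by
    have : J * r < J := by nlinarith
    rw [hc, hJdef] at this ⊢
    exact_mod_cast this
  rcases Nat.even_or_odd k with he | ho
  · rw [he.neg_pow, ← hKdef] at hfl ⊢
    have hpos : 0 < r := by
      refine lt_of_le_of_ne hr0 fun h => hmin k hkn he hk ⌊K * ξ⌋ ?_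
      linarith
    have hge : ξ ≤ r := by
      by_contra! hlt
      exact hPk ⟨hpos, hlt⟩
    have : Int.fract (K * (ξ + t)) = r + K * t := by
      rw [Int.fract_eq_iff]
      refine ⟨by linarith, by nlinarith, ⌊K * ξ⌋, ?_⟩
      linarith
    rw [this]; nlinarith
  · rw [ho.neg_pow, ← hKdef] at hfl ⊢
    have hjo : Odd (j + 1) := by
      rcases Nat.even_or_odd (j + 1) with h | h
      · exact absurd hn (by rw [← hkj]; exact Nat.not_even_iff_odd.2 (ho.add_even h))
      · exact h
    have hKt : s * (K * t) ≤ ξ + t := by nlinarith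
    have hJt : s * (J * t) ≤ ξ + t := by nlinarith
    rcases hr0.eq_or_lt with h | hpos
    · have : Int.fract (-K * (ξ + t)) = 1 - K * t := by
        rw [Int.fract_eq_iff]
        refine ⟨by nlinarith, by linarith, ⌊-K * ξ⌋ - 1, ?_⟩
        push_cast; linarith
      rw [this]; nlinarith
    · have hge : ξ ≤ r := by
        by_contra! hlt
        exact hPk ⟨hpos, hlt⟩
      have hKr : K * t < r := by
        have := hrpos hpos
        by_contra! hcon
        nlinarith
      have : Int.fract (-K * (ξ + t)) = r - K * t := by
        rw [Int.fract_eq_iff]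
        refine ⟨by linarith, by linarith, ⌊-K * ξ⌋, ?_⟩
        linarith
      rw [this]
      by_contra! hcon
      have hη : 0 < r - ξ := lt_of_le_of_ne (by linarith) (fun h => hne (by linarith))
      have hpos' : 0 < J * (r - ξ) := by positivity
      have hJpos : 0 < J := by linarith
      have hKpos : 0 < K := by linarith
      have hsum : ∀ u, s * u ≤ ξ + t → ξ + t + u ≤ 1 := fun u hu => by
        have : s * (ξ + t + u) ≤ s * 1 := by linarith
        exact le_of_mul_le_mul_left this (by linarith)
      have hlt : J * (r - ξ) < ξ + t + J * t := by
        have := mul_lt_mul_of_pos_left (show r - ξ < t + K * t by linarith) hJpos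
        linarith
      have hlt1 : J * (r - ξ) < 1 := hlt.trans_le (hsum _ hJt)
      have hrj := hcomp hjo hpos'.le hlt1
      rw [hrj] at hPj hcomp'
      have hge' : ξ ≤ J * (r - ξ) := by
        by_contra! hlt
        exact hPj ⟨hpos', hlt⟩
      have hlt2 : K * (J * (r - ξ) - ξ) < ξ + t + K * t := by
        have := mul_lt_mul_of_pos_left hlt hKpos
        linarith
      have hrk := hcomp' ho (mul_nonneg hKpos.le (by linarith)) (hlt2.trans_le (hsum _ hKt))
      have : (r - ξ - t - K * t) * (K * J - 1) = 0 := by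
        linear_combination -hrk + (-(1 + K)) * ht
      have hKJ : 1 < K * J := by nlinarith
      rcases mul_eq_zero.1 this with h | h <;> linarith

lemma mem_Eset_of_periodic {s n : ℕ} (hn : 1 ≤ n) {x : ℝ} (h0 : 0 ≤ x) (h1 : x ≤ 1)
    (hper : Int.fract ((-(s : ℝ)) ^ n * x) = x)
    (h : ∀ k, 1 ≤ k → k < n → x ≤ Int.fract ((-(s : ℝ)) ^ k * x)) : x ∈ Eset s := by
  refine ⟨⟨h0, h1⟩, fun k _ => ?_⟩
  rw [← gmap_iterate s x hn] at hper
  rw [← Function.IsPeriodicPt.iterate_mod_apply (f := gmap s) (n := n) hper]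
  rcases Nat.eq_zero_or_pos (k % n) with hz | hz
  · simp [hz]
  · rw [gmap_iterate s x hz]
    exact h _ hz (Nat.mod_lt _ hn)

/-- The set of parameters whose components are the matching intervals. -/
def matchingSet (s : ℕ) : Set ℝ := Set.Icc (0 : ℝ) ((s : ℝ) / (s + 1)) \ Eset s

lemma lt_of_mem_connectedComponentIn {s : ℕ} {ξ x b : ℝ} (hb : b ∈ Eset s)
    (hx : x ∈ connectedComponentIn (matchingSet s) ξ) (hξ : ξ ∈ matchingSet s) :
    (ξ < b → x < b) ∧ (b < ξ → b < x) := by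
  have hoc : (connectedComponentIn (matchingSet s) ξ).OrdConnected :=
    isPreconnected_connectedComponentIn.ordConnected
  have hnot : b ∉ connectedComponentIn (matchingSet s) ξ := fun h =>
    (connectedComponentIn_subset _ _ h).2 hb
  have hmem := mem_connectedComponentIn hξ
  constructor
  · intro h; by_contra! hc
    exact hnot (hoc.out hmem hx ⟨h.le, hc⟩)
  · intro h; by_contra! hc
    exact hnot (hoc.out hx hmem ⟨hc, h.le⟩)

lemma exists_lower_endpoint {s : ℕ} (hs : 2 ≤ s) {ξ : ℝ} (h0 : 0 < ξ)
    (h1 : ξ * (s + 1) < s) (hP : AvoidsBelow s ξ) {n : ℕ} (hn : Odd n) {p : ℤ}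
    (hp : (s : ℝ) ^ n * ξ = p) (hmin : ∀ i < n, Odd i → ∀ a : ℤ, (s : ℝ) ^ i * ξ ≠ a) :
    ∃ a ∈ Eset s, a < ξ ∧ (s : ℝ) ^ n * (ξ - a) < 1 := by
  have hs' : (2 : ℝ) ≤ s := by exact_mod_cast hs
  have hN : (0 : ℝ) < (s : ℝ) ^ n := by positivity
  set t : ℝ := ξ / ((s : ℝ) ^ n + 1) with ht
  have htn : (s : ℝ) ^ n * t = ξ - t := by rw [ht]; field_simp; ring
  have ht0 : 0 < t := by positivity
  have hN1 : (1 : ℝ) ≤ (s : ℝ) ^ n := one_le_pow₀ (by linarith)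
  have hξ1 : ξ < 1 := by nlinarith
  refine ⟨ξ - t, ?_, by linarith, by rw [sub_sub_cancel]; linarith⟩
  refine mem_Eset_of_periodic hn.pos (by nlinarith) (by linarith) ?_ fun k hk hkn =>
    le_fract_neg_pow_sub hs h0 h1 hP hn hp hmin hk hkn ht0 (by linarith)
  rw [Int.fract_eq_iff]
  refine ⟨by nlinarith, by linarith, -p, ?_⟩
  rw [hn.neg_pow]; push_cast; linarith

lemma exists_upper_endpoint {s : ℕ} (hs : 2 ≤ s) {ξ : ℝ} (h0 : 0 < ξ)
    (h1 : ξ * (s + 1) < s) (hP : AvoidsBelow s ξ) {n : ℕ} (hn : Even n) (hn1 : 1 ≤ n) {p : ℤ}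
    (hp : (s : ℝ) ^ n * ξ = p)
    (hmin : ∀ i < n, Even i → 1 ≤ i → ∀ a : ℤ, (s : ℝ) ^ i * ξ ≠ a) :
    ∃ b ∈ Eset s, ξ < b ∧ (s : ℝ) ^ n * (b - ξ) < 1 := by
  have hs' : (2 : ℝ) ≤ s := by exact_mod_cast hs
  have hN : (s : ℝ) ≤ (s : ℝ) ^ n := le_self_pow₀ (by linarith) (by omega)
  set t : ℝ := ξ / ((s : ℝ) ^ n - 1) with ht
  have hN1 : (0 : ℝ) < (s : ℝ) ^ n - 1 := by linarith
  have htn : (s : ℝ) ^ n * t = ξ + t := by rw [ht]; field_simp; ring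
  have ht0 : 0 < t := by positivity
  obtain ⟨c, hc⟩ : ((s : ℤ) + 1) ∣ (s : ℤ) ^ n - 1 := by
    have := sub_dvd_pow_sub_pow (-(s : ℤ)) 1 n
    rw [hn.neg_pow, one_pow] at this
    rw [← neg_dvd]
    convert this using 1; ring
  have hcR : (s : ℝ) ^ n - 1 = (s + 1) * c := by exact_mod_cast hc
  have hpc : p ≤ s * c := by
    have h2 : (p : ℝ) * (s + 1) < s * (s : ℝ) ^ n := by rw [← hp]; nlinarith
    have h3 : (p : ℝ) * (s + 1) < (s * c + 1) * (s + 1) := by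
      have : (s : ℝ) * (s : ℝ) ^ n = s * ((s + 1) * c) + s := by rw [← hcR]; ring
      linarith
    have h4 : (p : ℝ) < s * c + 1 := lt_of_mul_lt_mul_right h3 (by positivity)
    have h5 : p < s * c + 1 := by exact_mod_cast h4
    omega
  have hb : (ξ + t) * (s + 1) ≤ s := by
    have h2 : (p : ℝ) ≤ s * c := by exact_mod_cast hpc
    have h3 : (ξ + t) * ((s : ℝ) ^ n - 1) = p := by
      rw [← hp]; linear_combination htn
    refine le_of_mul_le_mul_right ?_ hN1
    calc (ξ + t) * (s + 1) * ((s : ℝ) ^ n - 1) = p * (s + 1) := by rw [← h3]; ring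
      _ ≤ s * c * (s + 1) := by gcongr
      _ = s * ((s : ℝ) ^ n - 1) := by rw [hcR]; ring
  have hb1 : ξ + t < 1 := by nlinarith
  refine ⟨ξ + t, ?_, by linarith, by rw [add_sub_cancel_left]; linarith⟩
  refine mem_Eset_of_periodic hn1 (by linarith) (by linarith) ?_ fun k hk hkn =>
    le_fract_neg_pow_add hs h0 hP hn hp hmin hk hkn ht0 htn hb
  rw [Int.fract_eq_iff]
  refine ⟨by linarith, hb1, p, ?_⟩
  rw [hn.neg_pow]; linarith

lemma mem_matchingSet_of_isSAdic {s : ℕ} (hs : 2 ≤ s) {ξ : ℝ} (h0 : 0 < ξ)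
    (h1 : ξ * (s + 1) ≤ s) (hξ : IsSAdic s ξ) : ξ ∈ matchingSet s := by
  have hs' : (2 : ℝ) ≤ s := by exact_mod_cast hs
  refine ⟨⟨h0.le, by rwa [le_div_iff₀ (by positivity)]⟩, fun hE => ?_⟩
  obtain ⟨p, m, hpm⟩ := hξ
  have hp : (s : ℝ) ^ m * ξ = (p : ℤ) := by rw [hpm]; push_cast; field_simp
  have := hE.2 (m + 1) (by omega)
  rw [gmap_iterate s ξ (by omega), fract_neg_pow_eq_zero hp (by omega)] at this
  linarith

lemma AvoidsBelow.isPseudocenter {s : ℕ} (hs : 2 ≤ s) {ξ : ℝ} (h0 : 0 < ξ)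
    (h1 : ξ * (s + 1) < s) (hP : AvoidsBelow s ξ) (hξ : IsSAdic s ξ) : IsPseudocenter s ξ := by
  have hs' : (2 : ℝ) ≤ s := by exact_mod_cast hs
  have hmem := mem_matchingSet_of_isSAdic hs h0 h1.le hξ
  refine ⟨hmem, hξ, ?_⟩
  obtain ⟨p₀, m₀, hpm₀⟩ := hξ
  have hint : ∀ n, m₀ ≤ n → ∃ p : ℤ, (s : ℝ) ^ n * ξ = p := by
    intro n hn
    obtain ⟨i, rfl⟩ := Nat.exists_eq_add_of_le hn
    refine ⟨s ^ i * p₀, ?_⟩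
    rw [hpm₀, pow_add]; push_cast; field_simp
  intro x hx hxs hxne m m' hm hm'
  by_contra! hle
  obtain ⟨q, hq⟩ := hm'.1
  have hdiff : ∀ n, m ≤ n → (∃ p : ℤ, (s : ℝ) ^ n * ξ = p) →
      ∃ d : ℤ, (s : ℝ) ^ n * (x - ξ) = d := by
    rintro n hn ⟨p, hp⟩
    obtain ⟨i, rfl⟩ := Nat.exists_eq_add_of_le (hle.trans hn)
    refine ⟨s ^ i * q - p, ?_⟩
    rw [mul_sub, hp, hq, pow_add]; push_cast; field_simp
  have hmle : ∀ n, (∃ p : ℤ, (s : ℝ) ^ n * ξ = p) → m ≤ n := by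
    rintro n ⟨p, hp⟩
    have hp0 : 0 ≤ p := by
      have : (0 : ℝ) ≤ p := by rw [← hp]; positivity
      exact_mod_cast this
    lift p to ℕ using hp0
    refine hm.2 n ⟨p, ?_⟩
    rw [eq_div_iff (by positivity), mul_comm]; exact_mod_cast hp
  rcases lt_or_gt_of_ne hxne with hlt | hgt
  · have hex : ∃ n, Odd n ∧ ∃ p : ℤ, (s : ℝ) ^ n * ξ = p :=
      ⟨2 * m₀ + 1, odd_two_mul_add_one _, hint _ (by omega)⟩
    classical
    obtain ⟨hn, hpn⟩ := Nat.find_spec hex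
    obtain ⟨p, hp⟩ := hpn
    obtain ⟨a, haE, haξ, ha⟩ := exists_lower_endpoint hs h0 h1 hP hn hp
      fun i hi hio b hb => Nat.find_min hex hi ⟨hio, b, hb⟩
    have hax := (lt_of_mem_connectedComponentIn haE hx hmem).2 haξ
    obtain ⟨d, hd⟩ := hdiff _ (hmle _ ⟨p, hp⟩) ⟨p, hp⟩
    have hN : (0 : ℝ) < (s : ℝ) ^ Nat.find hex := by positivity
    have hd0 : (d : ℝ) < 0 := by rw [← hd]; nlinarith
    have hd1 : (-1 : ℝ) < d := by rw [← hd]; nlinarith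
    have hd0' : d < 0 := by exact_mod_cast hd0
    have hd1' : -1 < d := by exact_mod_cast hd1
    omega
  · have hex : ∃ n, Even n ∧ 1 ≤ n ∧ ∃ p : ℤ, (s : ℝ) ^ n * ξ = p :=
      ⟨2 * (m₀ + 1), even_two_mul _, by omega, hint _ (by omega)⟩
    classical
    obtain ⟨hn, hn1, hpn⟩ := Nat.find_spec hex
    obtain ⟨p, hp⟩ := hpn
    obtain ⟨b, hbE, hbξ, hb⟩ := exists_upper_endpoint hs h0 h1 hP hn hn1 hp
      fun i hi hie hi1 c hc => Nat.find_min hex hi ⟨hie, hi1, c, hc⟩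
    have hbx := (lt_of_mem_connectedComponentIn hbE hx hmem).1 hbξ
    obtain ⟨d, hd⟩ := hdiff _ (hmle _ ⟨p, hp⟩) ⟨p, hp⟩
    have hN : (0 : ℝ) < (s : ℝ) ^ Nat.find hex := by positivity
    have hd0 : (0 : ℝ) < d := by rw [← hd]; nlinarith
    have hd1 : (d : ℝ) < 1 := by rw [← hd]; nlinarith
    have hd0' : 0 < d := by exact_mod_cast hd0
    have hd1' : d < 1 := by exact_mod_cast hd1
    omega

lemma exists_minDen {s : ℕ} {x : ℝ} (hx : IsSAdic s x) : ∃ m, MinDen s x m := by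
  classical
  obtain ⟨p, m, h⟩ := hx
  have hex : ∃ m, ∃ p : ℕ, x = (p : ℝ) / (s : ℝ) ^ m := ⟨m, p, h⟩
  exact ⟨Nat.find hex, Nat.find_spec hex, fun n hn => Nat.find_min' hex hn⟩

lemma zero_mem_Eset (s : ℕ) : (0 : ℝ) ∈ Eset s := by
  refine ⟨by simp, fun k hk => ?_⟩
  rw [gmap_iterate s 0 hk]
  exact Int.fract_nonneg _

lemma fract_neg_pow_fixed {s : ℕ} (hs : 2 ≤ s) (k : ℕ) :
    Int.fract ((-(s : ℝ)) ^ k * ((s : ℝ) / (s + 1))) = (s : ℝ) / (s + 1) := by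
  have hs' : (2 : ℝ) ≤ s := by exact_mod_cast hs
  obtain ⟨c, hc⟩ := sub_dvd_pow_sub_pow (-(s : ℤ)) 1 k
  have hcR : (-(s : ℝ)) ^ k - 1 = (-s - 1) * c := by
    rw [one_pow] at hc; exact_mod_cast hc
  rw [Int.fract_eq_iff]
  refine ⟨by positivity, by rw [div_lt_one (by positivity)]; linarith, -(s * c), ?_⟩
  push_cast
  rw [eq_add_of_sub_eq hcR]; field_simp; ring

lemma fixed_mem_Eset {s : ℕ} (hs : 2 ≤ s) : (s : ℝ) / (s + 1) ∈ Eset s := by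
  have hs' : (2 : ℝ) ≤ s := by exact_mod_cast hs
  refine ⟨⟨by positivity, by rw [div_le_one (by positivity)]; linarith⟩, fun k hk => ?_⟩
  rw [gmap_iterate s _ hk, fract_neg_pow_fixed hs]

lemma IsPseudocenter.bounds {s : ℕ} (hs : 2 ≤ s) {ξ : ℝ} (hξ : IsPseudocenter s ξ) :
    0 < ξ ∧ ξ * (s + 1) < s := by
  have hs' : (2 : ℝ) ≤ s := by exact_mod_cast hs
  obtain ⟨⟨⟨h0, h1⟩, hE⟩, -⟩ := hξ
  refine ⟨lt_of_le_of_ne h0 fun h => hE (h ▸ zero_mem_Eset s), ?_⟩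
  rw [← lt_div_iff₀ (by positivity)]
  exact lt_of_le_of_ne h1 fun h => hE (h ▸ fixed_mem_Eset hs)

lemma IsPseudocenter.avoidsBelow {s : ℕ} (hs : 2 ≤ s) {ξ : ℝ} (hξ : IsPseudocenter s ξ) :
    AvoidsBelow s ξ := by
  rintro k hk ⟨hr0, hrlt⟩
  have hs' : (2 : ℝ) ≤ s := by exact_mod_cast hs
  obtain ⟨h0, h1⟩ := hξ.bounds hs
  have hξ1 : ξ < 1 := by nlinarith
  obtain ⟨hmem, hsa, huniq⟩ := hξ
  obtain ⟨m, hm⟩ := exists_minDen hsa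
  have hK : (s : ℝ) ≤ s ^ k := le_self_pow₀ (by linarith) (by omega)
  have hfl := Int.floor_add_fract ((-(s : ℝ)) ^ k * ξ)
  set r := Int.fract ((-(s : ℝ)) ^ k * ξ) with hr
  have hkm : k < m := by
    by_contra! hle
    obtain ⟨p, hp⟩ := hm.1
    have hp' : (s : ℝ) ^ m * ξ = (p : ℤ) := by rw [hp]; push_cast; field_simp
    exact hr0.ne' (fract_neg_pow_eq_zero hp' hle)
  have key : ∀ x : ℝ, 0 < x → (∃ a : ℤ, (s : ℝ) ^ k * x = a) →
      Set.uIcc ξ x ⊆ Set.Icc (0 : ℝ) ((s : ℝ) / (s + 1)) \ Eset s → False := by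
    rintro x hx0 ⟨a, ha⟩ hsub
    have ha0 : 0 ≤ a := by
      have : (0 : ℝ) ≤ a := by rw [← ha]; positivity
      exact_mod_cast this
    lift a to ℕ using ha0
    have hxa : x = (a : ℝ) / (s : ℝ) ^ k := by
      rw [eq_div_iff (by positivity), mul_comm]; exact_mod_cast ha
    have hxs : IsSAdic s x := ⟨a, k, hxa⟩
    obtain ⟨m', hm'⟩ := exists_minDen hxs
    have hm'k : m' ≤ k := hm'.2 k ⟨a, hxa⟩
    have hxC := isPreconnected_uIcc.subset_connectedComponentIn Set.left_mem_uIcc hsub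
      Set.right_mem_uIcc
    have hne : x ≠ ξ := by
      rintro rfl
      exact absurd (hm.2 k ⟨a, hxa⟩) (by omega)
    exact absurd (huniq x hxC hxs hne m m' hm hm') (by omega)
  have hKpos : (0 : ℝ) < (s : ℝ) ^ k := by positivity
  set t : ℝ := r / (s : ℝ) ^ k with ht
  have htr : (s : ℝ) ^ k * t = r := by rw [ht]; field_simp
  have ht0 : 0 < t := by positivity
  rcases Nat.even_or_odd k with he | ho
  · rw [he.neg_pow] at hfl
    have hx0 : 0 < ξ - t := by nlinarith
    refine key (ξ - t) hx0 ⟨⌊(s : ℝ) ^ k * ξ⌋, by linarith⟩ ?_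
    rw [Set.uIcc_of_ge (by linarith)]
    rintro y ⟨hy1, hy2⟩
    refine ⟨⟨by linarith, hy2.trans hmem.1.2⟩, fun hE => ?_⟩
    have hge := hE.2 k hk
    have : Int.fract ((-(s : ℝ)) ^ k * y) = r - (s : ℝ) ^ k * (ξ - y) := by
      rw [Int.fract_eq_iff]
      refine ⟨by nlinarith, by nlinarith, ⌊(s : ℝ) ^ k * ξ⌋, ?_⟩
      rw [he.neg_pow]; linarith
    rw [gmap_iterate s y hk, this] at hge
    nlinarith
  · rw [ho.neg_pow] at hfl
    have hfr : ∀ y, ξ ≤ y → y ≤ ξ + t →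
        Int.fract ((-(s : ℝ)) ^ k * y) = r - (s : ℝ) ^ k * (y - ξ) := by
      intro y hy1 hy2
      rw [Int.fract_eq_iff]
      refine ⟨by nlinarith, by nlinarith, ⌊-(s : ℝ) ^ k * ξ⌋, ?_⟩
      rw [ho.neg_pow]; linarith
    have htop : ξ + t ≤ (s : ℝ) / (s + 1) := by
      by_contra! hgt
      have h2 := hfr _ hmem.1.2 hgt.le
      rw [fract_neg_pow_fixed hs] at h2
      have := hmem.1.2
      nlinarith
    refine key (ξ + t) (by linarith) ⟨-⌊-(s : ℝ) ^ k * ξ⌋, by push_cast; linarith⟩ ?_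
    rw [Set.uIcc_of_le (by linarith)]
    rintro y ⟨hy1, hy2⟩
    refine ⟨⟨by linarith, hy2.trans htop⟩, fun hE => ?_⟩
    have hge := hE.2 k hk
    rw [gmap_iterate s y hk, hfr y hy1 hy2] at hge
    nlinarith

lemma AvoidsBelow.doubling {s : ℕ} (hs : 2 ≤ s) {ξ : ℝ} (h0 : 0 < ξ)
    (h1 : ξ * (s + 1) < s) (hP : AvoidsBelow s ξ) {n : ℕ} (hn : Odd n) {p : ℤ}
    (hp : (s : ℝ) ^ n * ξ = p) (hmin : ∀ i < n, Odd i → ∀ a : ℤ, (s : ℝ) ^ i * ξ ≠ a) :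
    AvoidsBelow s (ξ - ξ / (s : ℝ) ^ n) := by
  have hs' : (2 : ℝ) ≤ s := by exact_mod_cast hs
  have hξ1 : ξ < 1 := by nlinarith
  have ht0 : 0 < ξ / (s : ℝ) ^ n := by positivity
  rintro k hk ⟨hk0, hklt⟩
  rcases lt_or_ge k n with hkn | hnk
  · exact absurd (le_fract_neg_pow_sub hs h0 h1 hP hn hp hmin hk hkn ht0
      (mul_div_cancel₀ ξ (by positivity)).le) (not_le.2 hklt)
  · obtain ⟨i, rfl⟩ := Nat.exists_eq_add_of_le hnk
    have heq : Int.fract ((-(s : ℝ)) ^ (n + i) * (ξ - ξ / (s : ℝ) ^ n)) =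
        Int.fract ((-(s : ℝ)) ^ i * ξ) := by
      rw [Int.fract_eq_fract]
      refine ⟨-((-(s : ℤ)) ^ i * p), ?_⟩
      push_cast
      rw [← hp, pow_add, hn.neg_pow]; field_simp; ring
    rw [heq] at hk0 hklt
    rcases Nat.eq_zero_or_pos i with rfl | hi
    · rw [pow_zero, one_mul, Int.fract_eq_self.2 ⟨h0.le, hξ1⟩] at hklt
      linarith
    · exact hP i hi ⟨hk0, by linarith⟩

lemma sval_append {s : ℕ} (hs : s ≠ 0) (a b : List ℕ) :
    sval s (a ++ b) = sval s a + sval s b / (s : ℝ) ^ a.length := by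
  have hs' : (s : ℝ) ≠ 0 := by exact_mod_cast hs
  induction a with
  | nil => simp [sval]
  | cons d a ih =>
    have h : ∀ l, sval s (d :: l) = ((d : ℝ) + sval s l) / s := fun _ => rfl
    rw [List.cons_append, h, h, ih, List.length_cons, pow_succ]
    field_simp; ring

lemma sval_flipw {s : ℕ} (hs : s ≠ 0) (v : List ℕ) (hv : ∀ d ∈ v, d < s) :
    sval s (flipw s v) = 1 - 1 / (s : ℝ) ^ v.length - sval s v := by
  have hs' : (s : ℝ) ≠ 0 := by exact_mod_cast hs
  induction v with
  | nil => simp [sval, flipw]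
  | cons d v ih =>
    have h : ∀ c l, sval s (c :: l) = ((c : ℝ) + sval s l) / s := fun _ _ => rfl
    have hd : d < s := hv d (by simp)
    have hf : flipw s (d :: v) = (s - 1 - d) :: flipw s v := rfl
    have hcast : ((s - 1 - d : ℕ) : ℝ) = s - 1 - d := by
      rw [Nat.cast_sub (by omega), Nat.cast_sub (by omega)]; simp
    rw [hf, h, h, ih fun c hc => hv c (by simp [hc]), hcast, List.length_cons, pow_succ]
    field_simp; ring

lemma exists_sval_eq {s : ℕ} (hs : s ≠ 0) (v : List ℕ) :
    ∃ p : ℕ, sval s v = (p : ℝ) / (s : ℝ) ^ v.length := by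
  have hs' : (s : ℝ) ≠ 0 := by exact_mod_cast hs
  induction v with
  | nil => exact ⟨0, by simp [sval]⟩
  | cons d v ih =>
    obtain ⟨p, hp⟩ := ih
    refine ⟨d * s ^ v.length + p, ?_⟩
    have h : sval s (d :: v) = ((d : ℝ) + sval s v) / s := rfl
    rw [h, hp, List.length_cons, pow_succ]; push_cast; field_simp

lemma exists_digits {s : ℕ} (hs : s ≠ 0) (k : ℕ) (p : ℕ) (hp : p < s ^ k) :
    ∃ v : List ℕ, (∀ d ∈ v, d < s) ∧ v.length = k ∧ sval s v = (p : ℝ) / (s : ℝ) ^ k := by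
  have hs' : (s : ℝ) ≠ 0 := by exact_mod_cast hs
  induction k generalizing p with
  | zero =>
    obtain rfl : p = 0 := by simpa using hp
    exact ⟨[], by simp, rfl, by simp [sval]⟩
  | succ k ih =>
    have hpos : 0 < s ^ k := pow_pos (Nat.pos_of_ne_zero hs) k
    obtain ⟨v, hv, hl, hval⟩ := ih (p % s ^ k) (Nat.mod_lt _ hpos)
    refine ⟨(p / s ^ k) :: v, ?_, by simp [hl], ?_⟩
    · intro d hd
      rcases List.mem_cons.1 hd with rfl | hd
      · rw [Nat.div_lt_iff_lt_mul hpos, mul_comm, ← pow_succ]; exact hp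
      · exact hv d hd
    · have h : sval s ((p / s ^ k) :: v) = (((p / s ^ k : ℕ) : ℝ) + sval s v) / s := rfl
      have hdm : (p : ℝ) = (s : ℝ) ^ k * ((p / s ^ k : ℕ) : ℝ) + ((p % s ^ k : ℕ) : ℝ) := by
        exact_mod_cast (Nat.div_add_mod p (s ^ k)).symm
      rw [h, hval, hdm, pow_succ]; field_simp

/-- period doubling: if `ξ` is a pseudocenter and `v` is the shortest
odd-length expansion of `1 − ξ`, then `ξ' = .v̌v` is also a pseudocenter; equivalently,
`g^k(ξ') ∉ (0, ξ')` for all `k ≥ 1`. -/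
theorem period_doubling_pseudocenter
    (s : ℕ) (hs : 2 ≤ s) (ξ : ℝ) (hξ : IsPseudocenter s ξ)
    (v : List ℕ) (hv : IsOddExp s (1 - ξ) v) :
    IsPseudocenter s (sval s (flipw s v ++ v)) ∧
    ∀ k : ℕ, 1 ≤ k →
      (gmap s)^[k] (sval s (flipw s v ++ v)) ∉ Set.Ioo 0 (sval s (flipw s v ++ v)) := by
  have hs0 : s ≠ 0 := by omega
  have hs' : (2 : ℝ) ≤ s := by exact_mod_cast hs
  obtain ⟨h0, h1⟩ := hξ.bounds hs
  have hξ1 : ξ < 1 := by nlinarith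
  obtain ⟨hdig, hodd, hval, hmin⟩ := hv
  have hNpos : ∀ i, (0 : ℝ) < (s : ℝ) ^ i := fun i => by positivity
  have hint : ∃ p : ℤ, (s : ℝ) ^ v.length * ξ = p := by
    obtain ⟨p, hp⟩ := exists_sval_eq hs0 v
    refine ⟨s ^ v.length - p, ?_⟩
    have hq : ξ = 1 - (p : ℝ) / (s : ℝ) ^ v.length := by linarith
    rw [hq]; push_cast; field_simp
  obtain ⟨p, hp⟩ := hint
  have hshort : ∀ i < v.length, Odd i → ∀ a : ℤ, (s : ℝ) ^ i * ξ ≠ a := by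
    intro i hi hio a ha
    have ha0 : (0 : ℝ) < a := by rw [← ha]; have := hNpos i; positivity
    have ha1 : (a : ℝ) < (s : ℝ) ^ i := by rw [← ha]; nlinarith [hNpos i]
    have ha0' : 0 < a := by exact_mod_cast ha0
    lift a to ℕ using ha0'.le
    have ha0'' : 0 < a := by exact_mod_cast ha0'
    have ha1' : a < s ^ i := by exact_mod_cast ha1
    obtain ⟨w, hw, hl, hwv⟩ := exists_digits hs0 i (s ^ i - a) (by omega)
    have hcast : ((s ^ i - a : ℕ) : ℝ) = (s : ℝ) ^ i - a := by
      rw [Nat.cast_sub ha1'.le]; push_cast; ring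
    have := hmin w hw (hl ▸ hio) (by
      rw [hwv, hcast, div_eq_iff (hNpos i).ne']
      push_cast at ha
      linarith)
    omega
  have heq : sval s (flipw s v ++ v) = ξ - ξ / (s : ℝ) ^ v.length := by
    rw [sval_append hs0, sval_flipw hs0 v hdig, hval]
    have : (flipw s v).length = v.length := by simp [flipw]
    rw [this]; field_simp; ring
  have hP' := (hξ.avoidsBelow hs).doubling hs h0 h1 hodd hp hshort
  have hsadic : IsSAdic s (sval s (flipw s v ++ v)) := by
    obtain ⟨q, hq⟩ := exists_sval_eq hs0 (flipw s v ++ v)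
    exact ⟨q, _, hq⟩
  have hN : (s : ℝ) ≤ (s : ℝ) ^ v.length := le_self_pow₀ (by linarith) hodd.pos.ne'
  have ht0 : 0 < ξ / (s : ℝ) ^ v.length := div_pos h0 (hNpos _)
  have htlt : ξ / (s : ℝ) ^ v.length < ξ := div_lt_self h0 (by linarith)
  rw [← heq] at hP'
  refine ⟨hP'.isPseudocenter hs (by rw [heq]; linarith) (by rw [heq]; nlinarith) hsadic,
    fun k hk => ?_⟩
  rw [gmap_iterate s _ hk]
  exact hP' k hk
end

section
/- Fix an integer s ≥ 2 and let M_s := [s/(s+1) − 1/s, s/(s+1)]. Then the Hausdorff dimension of M_s ∩ E is strictly positive. -/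
/-- A real-valued map on binary sequences that separates sequences first differing at place `n`
by at least a constant times `ρ ^ n` has range of positive Hausdorff dimension. -/
theorem dimH_range_pos_of_separated {F : (ℕ → Fin 2) → ℝ} {ρ κ : ℝ} (hρ : 0 < ρ) (hρ1 : ρ < 1)
    (hκ : 0 < κ)
    (hF : ∀ (n : ℕ) (x y : ℕ → Fin 2), (∀ i < n, x i = y i) → x n ≠ y n →
      κ * ρ ^ n ≤ |F x - F y|) :
    0 < dimH (Set.range F) := by
  obtain ⟨r, hr, hρr⟩ : ∃ r : ℝ, 0 < r ∧ ρ ^ r = 1 / 2 := by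
    refine ⟨Real.log (1 / 2) / Real.log ρ, ?_, ?_⟩
    · exact div_pos_of_neg_of_neg (Real.log_neg (by norm_num) (by norm_num))
        (Real.log_neg hρ hρ1)
    · rw [Real.rpow_def_of_pos hρ, mul_div_cancel₀ _ (Real.log_neg hρ hρ1).ne,
        Real.exp_log (by norm_num)]
  have key : ∀ x y, |Real.ofDigits x - Real.ofDigits y| ≤ (κ ^ r)⁻¹ * |F x - F y| ^ r := by
    intro x y
    rcases eq_or_ne x y with rfl | hxy
    · simpa using mul_nonneg (inv_nonneg.2 (Real.rpow_nonneg hκ.le r)) (Real.rpow_nonneg le_rfl r)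
    have hagree : ∀ i < PiNat.firstDiff x y, x i = y i :=
      fun i hi => PiNat.apply_eq_of_lt_firstDiff hi
    have hsep := hF _ x y hagree (PiNat.apply_firstDiff_ne hxy)
    refine (Real.abs_ofDigits_sub_ofDigits_le hagree).trans ?_
    rw [inv_mul_eq_div, le_div_iff₀ (Real.rpow_pos_of_pos hκ r), mul_comm]
    refine le_of_eq_of_le ?_ (Real.rpow_le_rpow (by positivity) hsep hr.le)
    rw [Real.mul_rpow hκ.le (by positivity), ← Real.rpow_natCast ρ, ← Real.rpow_mul hρ.le,
      mul_comm _ r, Real.rpow_mul hρ.le, hρr, Real.rpow_natCast]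
    simp
  set h : ℝ → ℝ := fun z => Real.ofDigits (Function.invFun F z)
  have hinv : ∀ x, F (Function.invFun F (F x)) = F x := fun x => Function.invFun_eq ⟨x, rfl⟩
  have hh : ∀ x, h (F x) = Real.ofDigits x := by
    intro x
    have := key (Function.invFun F (F x)) x
    rw [hinv, sub_self, abs_zero, Real.zero_rpow hr.ne', mul_zero] at this
    exact sub_eq_zero.1 (abs_eq_zero.1 (le_antisymm this (abs_nonneg _)))
  have hHolder : HolderOnWith (Real.toNNReal (κ ^ r)⁻¹) (Real.toNNReal r) h (Set.range F) := by
    rintro _ ⟨x, rfl⟩ _ ⟨y, rfl⟩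
    rw [hh, hh, edist_dist, edist_dist, Real.dist_eq, Real.dist_eq, Real.coe_toNNReal _ hr.le,
      ENNReal.ofReal_rpow_of_nonneg (abs_nonneg _) hr.le, ← ENNReal.ofReal.eq_1,
      ← ENNReal.ofReal_mul (by positivity)]
    exact ENNReal.ofReal_le_ofReal (key x y)
  have hsub : Set.Icc (0 : ℝ) 1 ⊆ h '' Set.range F := by
    intro t ht
    obtain ⟨x, -, rfl⟩ := Real.ofDigits_SurjOn (b := 2) (by norm_num) ht
    exact ⟨F x, ⟨x, rfl⟩, hh x⟩
  have hIcc : dimH (Set.Icc (0 : ℝ) 1) = 1 := by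
    rw [Real.dimH_of_nonempty_interior (by simp)]
    simp
  have hle := (dimH_mono hsub).trans (hHolder.dimH_image_le (Real.toNNReal_pos.2 hr))
  rw [hIcc] at hle
  rw [pos_iff_ne_zero]
  intro h0
  simp [h0] at hle

/-- The inverse branch of `gmap s` on which the integer part of `s (1 - x)` is `d`. -/
noncomputable def gbranch (s : ℕ) (d x : ℝ) : ℝ := 1 - (d + x) / s

theorem gmap_gbranch {s : ℕ} (hs : s ≠ 0) (d : ℕ) {x : ℝ} (hx : x ∈ Set.Ioo (0 : ℝ) 1) :
    gmap s (gbranch s d x) = x := by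
  have hs' : (s : ℝ) ≠ 0 := by exact_mod_cast hs
  have : (s : ℝ) * (1 - gbranch s d x) = d + x := by
    unfold gbranch
    field_simp
    ring
  rw [gmap, this, Int.fract_natCast_add, Int.fract_eq_self]
  exact ⟨hx.1.le, hx.2⟩

theorem gmap_gbranch_zero {s : ℕ} (hs : s ≠ 0) {x : ℝ} (hx : x ∈ Set.Ioo (0 : ℝ) 1) :
    gmap s (gbranch s 0 x) = x := by
  simpa using gmap_gbranch hs 0 hx

theorem gmap_gbranch_one {s : ℕ} (hs : s ≠ 0) {x : ℝ} (hx : x ∈ Set.Ioo (0 : ℝ) 1) :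
    gmap s (gbranch s 1 x) = x := by
  simpa using gmap_gbranch hs 1 hx

theorem gbranch_mem_Ioo {s : ℕ} (hs : 2 ≤ s) {d x : ℝ} (hd : d ∈ Set.Icc (0 : ℝ) 1)
    (hx : x ∈ Set.Ioo (0 : ℝ) 1) : gbranch s d x ∈ Set.Ioo (0 : ℝ) 1 := by
  have hs' : (2 : ℝ) ≤ s := by exact_mod_cast hs
  obtain ⟨hd0, hd1⟩ := hd
  obtain ⟨hx0, hx1⟩ := hx
  have h1 : (d + x) / s < 1 := by
    rw [div_lt_one (by linarith)]
    linarith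
  have h2 : 0 < (d + x) / s := by positivity
  constructor <;> unfold gbranch <;> linarith

/-- The points whose `gmap s`-itinerary is a concatenation of the blocks `100` (digit `0`)
and `111` (digit `1`). -/
noncomputable def blockPoint (s : ℕ) (ε : ℕ → Fin 2) : ℝ :=
  ∑' n, ((1 - 1 / (s : ℝ)) ^ 2 + (s - 1) / (s : ℝ) ^ 3 * (ε n : ℕ)) * (-(1 / (s : ℝ) ^ 3)) ^ n

theorem blockCoeff_mem_Icc {s : ℕ} (hs : 2 ≤ s) (d : Fin 2) :
    (1 - 1 / (s : ℝ)) ^ 2 + (s - 1) / (s : ℝ) ^ 3 * (d : ℕ) ∈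
      Set.Icc ((1 - 1 / (s : ℝ)) ^ 2) (1 - 1 / (s : ℝ) - 1 / (s : ℝ) ^ 3) := by
  have hs' : (2 : ℝ) ≤ s := by exact_mod_cast hs
  have hd0 : (0 : ℝ) ≤ (d : ℕ) := by positivity
  have hd1 : ((d : ℕ) : ℝ) ≤ 1 := by exact_mod_cast Nat.le_of_lt_succ d.isLt
  have hδ : 0 ≤ ((s : ℝ) - 1) / (s : ℝ) ^ 3 := div_nonneg (by linarith) (by positivity)
  have hbound : (1 - 1 / (s : ℝ)) ^ 2 + (s - 1) / (s : ℝ) ^ 3 ≤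
      1 - 1 / (s : ℝ) - 1 / (s : ℝ) ^ 3 := by
    have : 1 - 1 / (s : ℝ) - 1 / (s : ℝ) ^ 3 -
        ((1 - 1 / (s : ℝ)) ^ 2 + (s - 1) / (s : ℝ) ^ 3) = (s - 2) / (s : ℝ) ^ 2 := by
      field_simp
      ring
    have h2 : 0 ≤ ((s : ℝ) - 2) / (s : ℝ) ^ 2 := div_nonneg (by linarith) (by positivity)
    linarith
  constructor
  · nlinarith
  · nlinarith

theorem one_div_cube_mem_Ioc {s : ℕ} (hs : 2 ≤ s) :
    1 / (s : ℝ) ^ 3 ∈ Set.Ioc (0 : ℝ) (1 / 8) := by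
  have hs' : (2 : ℝ) ≤ s := by exact_mod_cast hs
  refine ⟨by positivity, one_div_le_one_div_of_le (by norm_num) ?_⟩
  calc (8 : ℝ) = 2 ^ 3 := by norm_num
    _ ≤ (s : ℝ) ^ 3 := by gcongr

theorem norm_blockTerm_le {s : ℕ} (hs : 2 ≤ s) (ε : ℕ → Fin 2) (n : ℕ) :
    ‖((1 - 1 / (s : ℝ)) ^ 2 + (s - 1) / (s : ℝ) ^ 3 * (ε n : ℕ)) * (-(1 / (s : ℝ) ^ 3)) ^ n‖ ≤
      (1 - 1 / (s : ℝ) ^ 3) * (1 / (s : ℝ) ^ 3) ^ n := by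
  obtain ⟨h0, h1⟩ := blockCoeff_mem_Icc hs (ε n)
  obtain ⟨hρ0, -⟩ := one_div_cube_mem_Ioc hs
  have hinv : 0 ≤ 1 / (s : ℝ) := by positivity
  rw [norm_mul, norm_pow, norm_neg, Real.norm_of_nonneg hρ0.le,
    Real.norm_of_nonneg ((sq_nonneg _).trans h0)]
  exact mul_le_mul_of_nonneg_right (by linarith) (by positivity)

theorem hasSum_blockBound {s : ℕ} (hs : 2 ≤ s) :
    HasSum (fun n : ℕ => (1 - 1 / (s : ℝ) ^ 3) * (1 / (s : ℝ) ^ 3) ^ n) 1 := by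
  obtain ⟨hρ0, hρ1⟩ := one_div_cube_mem_Ioc hs
  have h := (hasSum_geometric_of_lt_one hρ0.le (by linarith)).mul_left (1 - 1 / (s : ℝ) ^ 3)
  rwa [mul_inv_cancel₀ (by linarith)] at h

theorem blockPoint_eq {s : ℕ} (hs : 2 ≤ s) (ε : ℕ → Fin 2) :
    blockPoint s ε = (1 - 1 / (s : ℝ)) ^ 2 + (s - 1) / (s : ℝ) ^ 3 * (ε 0 : ℕ) -
      1 / (s : ℝ) ^ 3 * blockPoint s (fun n => ε (n + 1)) := by
  have hsum := Summable.of_norm_bounded (hasSum_blockBound hs).summable (norm_blockTerm_le hs ε)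
  rw [blockPoint, hsum.tsum_eq_zero_add, blockPoint, ← tsum_mul_left, pow_zero, mul_one,
    sub_eq_add_neg _ (∑' _, _), ← tsum_neg]
  congr 2
  ext n
  ring

theorem blockPoint_mem_Ioc {s : ℕ} (hs : 2 ≤ s) (ε : ℕ → Fin 2) :
    blockPoint s ε ∈ Set.Ioc 0 (1 - 1 / (s : ℝ)) := by
  have hs' : (2 : ℝ) ≤ s := by exact_mod_cast hs
  have habs : |blockPoint s (fun n => ε (n + 1))| ≤ 1 :=
    tsum_of_norm_bounded (hasSum_blockBound hs) (norm_blockTerm_le hs fun n => ε (n + 1))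
  obtain ⟨hl, hu⟩ := abs_le.1 habs
  obtain ⟨hρ0, hρ1⟩ := one_div_cube_mem_Ioc hs
  obtain ⟨h0, h1⟩ := blockCoeff_mem_Icc hs (ε 0)
  have hinv : 1 / (s : ℝ) ≤ 1 / 2 := one_div_le_one_div_of_le (by norm_num) hs'
  rw [blockPoint_eq hs]
  constructor <;> nlinarith

theorem blockPoint_mem_Ioo {s : ℕ} (hs : 2 ≤ s) (ε : ℕ → Fin 2) :
    blockPoint s ε ∈ Set.Ioo (0 : ℝ) 1 := by
  obtain ⟨h0, h1⟩ := blockPoint_mem_Ioc hs ε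
  have : 0 < 1 / (s : ℝ) := by positivity
  exact ⟨h0, by linarith⟩

theorem blockPoint_eq_gbranch {s : ℕ} (hs : 2 ≤ s) (ε : ℕ → Fin 2) :
    blockPoint s ε =
        gbranch s 1 (gbranch s 0 (gbranch s 0 (blockPoint s fun n => ε (n + 1)))) ∨
      blockPoint s ε =
        gbranch s 1 (gbranch s 1 (gbranch s 1 (blockPoint s fun n => ε (n + 1)))) := by
  have hs' : (s : ℝ) ≠ 0 := by positivity
  rw [blockPoint_eq hs]
  generalize blockPoint s (fun n => ε (n + 1)) = x
  generalize ε 0 = d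
  unfold gbranch
  fin_cases d
  · left
    field_simp
    simp
    ring
  · right
    field_simp
    simp
    ring

theorem blockPoint_separated {s : ℕ} (hs : 2 ≤ s) (n : ℕ) (x y : ℕ → Fin 2)
    (hxy : ∀ i < n, x i = y i) (hne : x n ≠ y n) :
    1 / (s : ℝ) ^ 4 * (1 / (s : ℝ) ^ 3) ^ n ≤ |blockPoint s x - blockPoint s y| := by
  have hs' : (2 : ℝ) ≤ s := by exact_mod_cast hs
  obtain ⟨hρ0, -⟩ := one_div_cube_mem_Ioc hs
  induction n generalizing x y with
  | zero =>
    wlog hlt : y 0 < x 0 generalizing x y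
    · rw [abs_sub_comm]
      exact this y x (fun i hi => (hxy i hi).symm) hne.symm
        (lt_of_le_of_ne (not_lt.1 hlt) hne)
    have hx0 : ((x 0 : ℕ) : ℝ) = 1 := by
      norm_cast
      omega
    have hy0 : ((y 0 : ℕ) : ℝ) = 0 := by
      norm_cast
      omega
    obtain ⟨hx1, hx2⟩ := blockPoint_mem_Ioc hs fun n => x (n + 1)
    obtain ⟨hy1, hy2⟩ := blockPoint_mem_Ioc hs fun n => y (n + 1)
    refine le_trans ?_ (le_abs_self _)
    rw [blockPoint_eq hs x, blockPoint_eq hs y, hx0, hy0]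
    have hdiff : 1 / (s : ℝ) ^ 3 *
        (blockPoint s (fun n => x (n + 1)) - blockPoint s fun n => y (n + 1)) ≤
        1 / (s : ℝ) ^ 3 * (1 - 1 / (s : ℝ)) :=
      mul_le_mul_of_nonneg_left (by linarith) hρ0.le
    have hgap : 1 / (s : ℝ) ^ 4 ≤
        (s - 1) / (s : ℝ) ^ 3 - 1 / (s : ℝ) ^ 3 * (1 - 1 / (s : ℝ)) := by
      have : (s - 1) / (s : ℝ) ^ 3 - 1 / (s : ℝ) ^ 3 * (1 - 1 / (s : ℝ)) - 1 / (s : ℝ) ^ 4 =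
          (s - 2) / (s : ℝ) ^ 3 := by
        field_simp
        ring
      have h2 : 0 ≤ ((s : ℝ) - 2) / (s : ℝ) ^ 3 := div_nonneg (by linarith) (by positivity)
      linarith
    linarith
  | succ n ih =>
    have h := ih (fun n => x (n + 1)) (fun n => y (n + 1))
      (fun i hi => hxy (i + 1) (by omega)) hne
    rw [blockPoint_eq hs x, blockPoint_eq hs y, hxy 0 (by omega), sub_sub_sub_cancel_left,
      ← mul_sub, abs_mul, abs_of_pos hρ0, abs_sub_comm,
      pow_succ' (1 / (s : ℝ) ^ 3)]
    calc 1 / (s : ℝ) ^ 4 * (1 / (s : ℝ) ^ 3 * (1 / (s : ℝ) ^ 3) ^ n)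
        = 1 / (s : ℝ) ^ 3 * (1 / (s : ℝ) ^ 4 * (1 / (s : ℝ) ^ 3) ^ n) := by ring
      _ ≤ _ := mul_le_mul_of_nonneg_left h hρ0.le

/-- The point with itinerary `10000` followed by that of `blockPoint s ε`. -/
noncomputable def plateauPoint (s : ℕ) (ε : ℕ → Fin 2) : ℝ :=
  gbranch s 1 ((gbranch s 0)^[4] (blockPoint s ε))

theorem gbranch_one_anti {s : ℕ} {x y : ℝ} (h : x ≤ y) : gbranch s 1 y ≤ gbranch s 1 x := by
  unfold gbranch
  gcongr

theorem iterate_four_gbranch_zero {s : ℕ} (hs : s ≠ 0) (x : ℝ) :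
    (gbranch s 0)^[4] x = (s : ℝ) / (s + 1) - ((s : ℝ) / (s + 1) - x) / (s : ℝ) ^ 4 := by
  have hs' : (s : ℝ) ≠ 0 := by exact_mod_cast hs
  simp only [Function.iterate_succ, Function.iterate_zero, Function.comp, id, gbranch]
  field_simp
  ring

theorem le_iterate_four_gbranch_zero {s : ℕ} (hs : 2 ≤ s) {x y : ℝ} (hx : 0 ≤ x)
    (hy : y ≤ gbranch s 0 (gbranch s 0 (1 - 1 / (s : ℝ)))) :
    y ≤ (gbranch s 0)^[4] x := by
  have hs' : (2 : ℝ) ≤ s := by exact_mod_cast hs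
  refine hy.trans ?_
  rw [iterate_four_gbranch_zero (by omega)]
  have : (s : ℝ) / (s + 1) - ((s : ℝ) / (s + 1) - x) / (s : ℝ) ^ 4 -
      gbranch s 0 (gbranch s 0 (1 - 1 / (s : ℝ))) = x / (s : ℝ) ^ 4 := by
    unfold gbranch
    field_simp
    ring
  have h2 : 0 ≤ x / (s : ℝ) ^ 4 := by positivity
  linarith

theorem plateauPoint_le_gbranch_zero {s : ℕ} (hs : 2 ≤ s) (ε : ℕ → Fin 2) {y : ℝ} (hy : y ≤ 1) :
    plateauPoint s ε ≤ gbranch s 0 y := by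
  have h0 : ∀ {x : ℝ}, x ∈ Set.Ioo (0 : ℝ) 1 → gbranch s 0 x ∈ Set.Ioo (0 : ℝ) 1 :=
    gbranch_mem_Ioo hs (by simp)
  have h := (h0 (h0 (h0 (h0 (blockPoint_mem_Ioo hs ε))))).1.le
  have h' : 0 ≤ (gbranch s 0)^[4] (blockPoint s ε) := h
  rw [plateauPoint]
  generalize (gbranch s 0)^[4] (blockPoint s ε) = z at h'
  unfold gbranch
  gcongr 1 - ?_ / _
  linarith

theorem plateauPoint_le_gbranch_one {s : ℕ} (hs : 2 ≤ s) (ε : ℕ → Fin 2) {y : ℝ}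
    (hy : y ≤ gbranch s 0 (gbranch s 0 (1 - 1 / (s : ℝ)))) :
    plateauPoint s ε ≤ gbranch s 1 y :=
  gbranch_one_anti (le_iterate_four_gbranch_zero hs (blockPoint_mem_Ioo hs ε).1.le hy)

/-- The points eventually visited by the orbits of the `plateauPoint s ε`. -/
inductive IsTail (s : ℕ) : ℝ → Prop
  | block (ε : ℕ → Fin 2) : IsTail s (blockPoint s ε)
  | zero (x : ℝ) : IsTail s x → IsTail s (gbranch s 0 x)
  | one (ε : ℕ → Fin 2) : IsTail s (gbranch s 1 (blockPoint s ε))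
  | one_one (ε : ℕ → Fin 2) : IsTail s (gbranch s 1 (gbranch s 1 (blockPoint s ε)))

theorem IsTail.mem_Ioo {s : ℕ} (hs : 2 ≤ s) {x : ℝ} (hx : IsTail s x) :
    x ∈ Set.Ioo (0 : ℝ) 1 := by
  induction hx with
  | block ε => exact blockPoint_mem_Ioo hs ε
  | zero x _ ih => exact gbranch_mem_Ioo hs (by simp) ih
  | one ε => exact gbranch_mem_Ioo hs (by simp) (blockPoint_mem_Ioo hs ε)
  | one_one ε =>
    exact gbranch_mem_Ioo hs (by simp) (gbranch_mem_Ioo hs (by simp) (blockPoint_mem_Ioo hs ε))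

theorem IsTail.gmap_apply {s : ℕ} (hs : 2 ≤ s) {x : ℝ} (hx : IsTail s x) : IsTail s (gmap s x) := by
  have hs0 : s ≠ 0 := by omega
  cases hx with
  | block ε =>
    rcases blockPoint_eq_gbranch hs ε with h | h
    · have ht : IsTail s (gbranch s 0 (gbranch s 0 (blockPoint s fun n => ε (n + 1)))) :=
        .zero _ (.zero _ (.block _))
      rwa [h, gmap_gbranch_one hs0 (ht.mem_Ioo hs)]
    · have ht : IsTail s (gbranch s 1 (gbranch s 1 (blockPoint s fun n => ε (n + 1)))) :=
        .one_one _
      rwa [h, gmap_gbranch_one hs0 (ht.mem_Ioo hs)]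
  | zero x h => rwa [gmap_gbranch_zero hs0 (h.mem_Ioo hs)]
  | one ε =>
    rw [gmap_gbranch_one hs0 (blockPoint_mem_Ioo hs ε)]
    exact .block ε
  | one_one ε =>
    rw [gmap_gbranch_one hs0 ((IsTail.one ε).mem_Ioo hs)]
    exact .one ε

theorem one_sub_inv_le_gbranch_zero {s : ℕ} {x : ℝ} (hx : x ≤ 1) :
    1 - 1 / (s : ℝ) ≤ gbranch s 0 x := by
  unfold gbranch
  gcongr
  linarith

theorem gbranch_one_le {s : ℕ} {x : ℝ} (hx : 0 ≤ x) : gbranch s 1 x ≤ 1 - 1 / (s : ℝ) := by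
  unfold gbranch
  gcongr
  linarith

theorem gbranch_zero_gbranch_zero_mono {s : ℕ} {x y : ℝ} (h : x ≤ y) :
    gbranch s 0 (gbranch s 0 x) ≤ gbranch s 0 (gbranch s 0 y) := by
  unfold gbranch
  gcongr

theorem IsTail.plateauPoint_le {s : ℕ} (hs : 2 ≤ s) (ε : ℕ → Fin 2) {x : ℝ} (hx : IsTail s x) :
    plateauPoint s ε ≤ x := by
  have hc : 1 - 1 / (s : ℝ) ≤ gbranch s 0 (gbranch s 0 (1 - 1 / (s : ℝ))) := by
    refine one_sub_inv_le_gbranch_zero ?_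
    have hs' : (2 : ℝ) ≤ s := by exact_mod_cast hs
    have hinv : 1 / (s : ℝ) ≤ 1 / 2 := one_div_le_one_div_of_le (by norm_num) hs'
    unfold gbranch
    have : 0 ≤ (0 + (1 - 1 / (s : ℝ))) / s := div_nonneg (by linarith) (by linarith)
    linarith
  have hb : ∀ ε', blockPoint s ε' ≤ 1 - 1 / (s : ℝ) := fun ε' => (blockPoint_mem_Ioc hs ε').2
  have hone : ∀ ε', gbranch s 1 (blockPoint s ε') ≤ 1 - 1 / (s : ℝ) :=
    fun ε' => gbranch_one_le (blockPoint_mem_Ioo hs ε').1.le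
  have hone_one : ∀ ε', gbranch s 1 (gbranch s 1 (blockPoint s ε')) ≤ 1 - 1 / (s : ℝ) :=
    fun ε' => gbranch_one_le ((IsTail.one ε').mem_Ioo hs).1.le
  cases hx with
  | block ε' =>
    rcases blockPoint_eq_gbranch hs ε' with h | h
    · rw [h]
      exact plateauPoint_le_gbranch_one hs ε (gbranch_zero_gbranch_zero_mono (hb _))
    · rw [h]
      exact plateauPoint_le_gbranch_one hs ε ((hone_one _).trans hc)
  | zero y h => exact plateauPoint_le_gbranch_zero hs ε (h.mem_Ioo hs).2.le
  | one ε' => exact plateauPoint_le_gbranch_one hs ε ((hb ε').trans hc)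
  | one_one ε' => exact plateauPoint_le_gbranch_one hs ε ((hone ε').trans hc)

theorem plateauPoint_mem {s : ℕ} (hs : 2 ≤ s) (ε : ℕ → Fin 2) :
    plateauPoint s ε ∈
      Set.Icc ((s : ℝ) / (s + 1) - 1 / s) ((s : ℝ) / (s + 1)) ∩ Eset s := by
  have hs' : (2 : ℝ) ≤ s := by exact_mod_cast hs
  have htail : IsTail s ((gbranch s 0)^[4] (blockPoint s ε)) :=
    .zero _ (.zero _ (.zero _ (.zero _ (.block ε))))
  have hmem : plateauPoint s ε ∈ Set.Ioo (0 : ℝ) 1 :=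
    gbranch_mem_Ioo hs (by simp) (htail.mem_Ioo hs)
  have hfix : 1 - 1 / (s : ℝ) ≤ s / (s + 1) := by
    rw [← sub_nonneg]
    have : (s : ℝ) / (s + 1) - (1 - 1 / (s : ℝ)) = 1 / (s * (s + 1)) := by
      field_simp
      ring
    rw [this]
    positivity
  have hb := (blockPoint_mem_Ioc hs ε).2.trans hfix
  refine ⟨⟨?_, ((IsTail.block ε).plateauPoint_le hs ε).trans hb⟩, ⟨hmem.1.le, hmem.2.le⟩, ?_⟩
  · have hle : (gbranch s 0)^[4] (blockPoint s ε) ≤ s / (s + 1) := by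
      rw [iterate_four_gbranch_zero (by omega)]
      have : 0 ≤ ((s : ℝ) / (s + 1) - blockPoint s ε) / (s : ℝ) ^ 4 :=
        div_nonneg (by linarith) (by positivity)
      linarith
    refine le_of_eq_of_le ?_ (gbranch_one_anti hle)
    unfold gbranch
    field_simp
    ring
  · intro k hk
    obtain ⟨k, rfl⟩ := Nat.exists_eq_add_of_le' hk
    have hiter : ∀ k, IsTail s ((gmap s)^[k + 1] (plateauPoint s ε)) := by
      intro k
      induction k with
      | zero =>
        rw [Function.iterate_one, plateauPoint, gmap_gbranch_one (by omega) (htail.mem_Ioo hs)]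
        exact htail
      | succ k ih =>
        rw [Function.iterate_succ_apply']
        exact ih.gmap_apply hs
    exact (hiter k).plateauPoint_le hs ε

theorem plateauPoint_sub {s : ℕ} (hs : s ≠ 0) (x y : ℕ → Fin 2) :
    plateauPoint s x - plateauPoint s y = (blockPoint s y - blockPoint s x) / (s : ℝ) ^ 5 := by
  have hs' : (s : ℝ) ≠ 0 := by exact_mod_cast hs
  rw [plateauPoint, plateauPoint, iterate_four_gbranch_zero hs, iterate_four_gbranch_zero hs]
  unfold gbranch
  field_simp
  ring

/-- for the top plateau `M_s = [s/(s+1) − 1/s, s/(s+1)]` the intersection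
`M_s ∩ E` has strictly positive Hausdorff dimension. -/
theorem top_plateau_positive_dimension (s : ℕ) (hs : 2 ≤ s) :
    0 < dimH (Set.Icc ((s : ℝ) / (s + 1) - 1 / s) ((s : ℝ) / (s + 1)) ∩ Eset s) := by
  obtain ⟨hρ0, hρ1⟩ := one_div_cube_mem_Ioc hs
  have hpos : 0 < (s : ℝ) := by positivity
  refine lt_of_lt_of_le
    (dimH_range_pos_of_separated (F := plateauPoint s) (κ := 1 / (s : ℝ) ^ 4 / (s : ℝ) ^ 5)
      hρ0 (by linarith) (by positivity) ?_)
    (dimH_mono (Set.range_subset_iff.2 (plateauPoint_mem hs)))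
  intro n x y hxy hne
  rw [plateauPoint_sub (by omega), abs_div, abs_sub_comm, abs_of_pos (pow_pos hpos 5),
    div_mul_eq_mul_div]
  exact div_le_div_of_nonneg_right (blockPoint_separated hs n x y hxy hne) (pow_pos hpos 5).le
end
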